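/- arXiv:1008.3735 — 5 statements merged into one kernel-verified Lean document; each statement's English description precedes it below -/
import Mathlib

section
/- Let α0,α1,α2,α3,α4 be complex numbers with α0+α1+2α2+2α3+2α4=1, α0−α1=0, α3+α4=0 and α4 ≠ 0. Then the quadruple x(t)≡0, y(t)≡1/2, z(t)=t/(2α4), w(t)≡0 is a rational solution of the Sasano system B4(α0,α1,α2,α3,α4), and it is the unique rational solution: every rational solution of B4(α0,α1,α2,α3,α4) equals this quadruple. -/
open Filter Topology Polynomial

noncomputable section

/-- The four equations of the Sasano system of type `B₄⁽¹⁾` at the point `t`. -/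
def B4Eqs (a0 a1 a2 a3 a4 : ℂ) (x y z w : ℂ → ℂ) (t : ℂ) : Prop :=
  (t * deriv x t =
      2 * x t ^ 2 * y t - x t ^ 2 + (1 - 2*a2 - 2*a3 - 2*a4) * x t
        + 2 * a3 * z t + 2 * z t ^ 2 * w t + t) ∧
  (t * deriv y t =
      -2 * x t * y t ^ 2 + 2 * x t * y t - (1 - 2*a2 - 2*a3 - 2*a4) * y t + a1) ∧
  (t * deriv z t =
      2 * z t ^ 2 * w t - z t ^ 2 + (1 - 2*a4) * z t + 2 * y t * z t ^ 2 + t) ∧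
  (t * deriv w t =
      -2 * z t * w t ^ 2 + 2 * z t * w t - (1 - 2*a4) * w t
        - 2 * a3 * y t - 4 * y t * z t * w t + a3)

/-- A complex rational function: a quotient of two polynomials (with junk value `0`
at poles), regarded as a function on `ℂ`. -/
def IsRatFn (f : ℂ → ℂ) : Prop :=
  ∃ p q : Polynomial ℂ, q ≠ 0 ∧ ∀ t : ℂ, f t = p.eval t / q.eval t

/-- A rational solution of the Sasano system `B₄⁽¹⁾`: a quadruple of rational functions
satisfying the four equations outside a finite set. -/
def IsRatSolB4 (a0 a1 a2 a3 a4 : ℂ) (x y z w : ℂ → ℂ) : Prop :=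
  IsRatFn x ∧ IsRatFn y ∧ IsRatFn z ∧ IsRatFn w ∧
    ∃ S : Set ℂ, S.Finite ∧ ∀ t ∉ S, B4Eqs a0 a1 a2 a3 a4 x y z w t

namespace B4aux

/-- degree at infinity at most `n` -/
def Le (n : ℤ) (f : RatFunc ℂ) : Prop := f = 0 ∨ f.intDegree ≤ n

lemma Le.mono {m n : ℤ} {f : RatFunc ℂ} (h : Le m f) (hmn : m ≤ n) : Le n f :=
  h.imp id (fun h => h.trans hmn)

lemma Le.zero (n : ℤ) : Le n 0 := Or.inl rfl

lemma Le.add {n : ℤ} {f g : RatFunc ℂ} (hf : Le n f) (hg : Le n g) : Le n (f + g) := by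
  by_cases hg0 : g = 0
  · simpa [hg0] using hf
  by_cases hf0 : f = 0
  · simpa [hf0] using hg
  by_cases hfg : f + g = 0
  · exact Or.inl hfg
  · right
    have h1 := hf.resolve_left hf0
    have h2 := hg.resolve_left hg0
    exact (RatFunc.intDegree_add_le hg0 hfg).trans (max_le h1 h2)

lemma Le.neg {n : ℤ} {f : RatFunc ℂ} (hf : Le n f) : Le n (-f) := by
  rcases hf with h | h
  · left; simp [h]
  · right; simpa using h

lemma Le.sub {n : ℤ} {f g : RatFunc ℂ} (hf : Le n f) (hg : Le n g) : Le n (f - g) := by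
  rw [sub_eq_add_neg]; exact hf.add hg.neg

lemma Le.mul {m n : ℤ} {f g : RatFunc ℂ} (hf : Le m f) (hg : Le n g) : Le (m + n) (f * g) := by
  by_cases hg0 : g = 0
  · left; simp [hg0]
  by_cases hf0 : f = 0
  · left; simp [hf0]
  right
  have h1 := hf.resolve_left hf0
  have h2 := hg.resolve_left hg0
  rw [RatFunc.intDegree_mul hf0 hg0]; omega

lemma Le.C (c : ℂ) : Le 0 (RatFunc.C c) := by right; simp

lemma Le.one : Le 0 1 := by right; simp

lemma Le.two : Le 0 2 := by
  have := Le.C 2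
  rwa [map_ofNat] at this

lemma Le.tX : Le 1 RatFunc.X := by right; simp

lemma Le.self (f : RatFunc ℂ) : Le f.intDegree f := Or.inr le_rfl

lemma Le.inv (f : RatFunc ℂ) : Le (-f.intDegree) f⁻¹ := by right; simp

lemma Le.deg {n : ℤ} {f : RatFunc ℂ} (h : Le n f) (hf : f ≠ 0) : f.intDegree ≤ n :=
  h.resolve_left hf

lemma Le.cmul {n : ℤ} {f : RatFunc ℂ} (c : ℂ) (h : Le n f) : Le n (RatFunc.C c * f) := by
  simpa using (Le.C c).mul h

lemma Le.tmul {n : ℤ} {f : RatFunc ℂ} (h : Le n f) : Le n (2 * f) := by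
  simpa using Le.two.mul h

lemma Le.of_cmul {n : ℤ} {f : RatFunc ℂ} {c : ℂ} (hc : c ≠ 0) (h : Le n (RatFunc.C c * f)) :
    Le n f := by
  have := h.cmul c⁻¹
  rwa [← mul_assoc, ← map_mul, inv_mul_cancel₀ hc, map_one, one_mul] at this

lemma Le.of_tmul {n : ℤ} {f : RatFunc ℂ} (h : Le n (2 * f)) : Le n f := by
  apply Le.of_cmul (c := 2) two_ne_zero
  rwa [map_ofNat]

lemma Le.eq_zero {f : RatFunc ℂ} (h : ∀ n : ℕ, Le (-(n : ℤ)) f) : f = 0 := by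
  by_contra hf
  have := (h (f.intDegree.natAbs + 1)).deg hf
  push_cast at this
  have := neg_abs_le f.intDegree
  omega

/-- the Euler derivation `t d/dt` on rational functions -/
def D (f : RatFunc ℂ) : RatFunc ℂ :=
  algebraMap ℂ[X] (RatFunc ℂ) (X * (derivative f.num * f.denom - f.num * derivative f.denom)) /
    algebraMap ℂ[X] (RatFunc ℂ) (f.denom ^ 2)

lemma am_ne {q : ℂ[X]} (hq : q ≠ 0) : algebraMap ℂ[X] (RatFunc ℂ) q ≠ 0 :=
  RatFunc.algebraMap_ne_zero hq

lemma quot_aux {R : Type*} [CommRing R] (c p q P Q p' q' P' Q' : R) (h1 : P * q = p * Q)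
    (h2 : P' * q + P * q' = p' * Q + p * Q') :
    c * (P' * Q - P * Q') * q ^ 2 = c * (p' * q - p * q') * Q ^ 2 := by
  linear_combination (c * q * Q) * h2 - (c * q' * Q + c * q * Q') * h1

lemma D_of_eq (f : RatFunc ℂ) (p q : ℂ[X]) (hq : q ≠ 0)
    (hf : f = algebraMap ℂ[X] (RatFunc ℂ) p / algebraMap ℂ[X] (RatFunc ℂ) q) :
    D f = algebraMap ℂ[X] (RatFunc ℂ) (X * (derivative p * q - p * derivative q)) /
        algebraMap ℂ[X] (RatFunc ℂ) (q ^ 2) := by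
  have hd : f.denom ≠ 0 := f.denom_ne_zero
  have h1 : f.num * q = p * f.denom := by
    have h := (RatFunc.num_div_denom f).trans hf
    rw [div_eq_div_iff (am_ne hd) (am_ne hq), ← map_mul, ← map_mul] at h
    exact RatFunc.algebraMap_injective ℂ h
  have h2 := congrArg derivative h1
  rw [derivative_mul, derivative_mul] at h2
  have h3 := quot_aux X p q f.num f.denom _ _ _ _ h1 h2
  unfold D
  rw [div_eq_div_iff (am_ne (pow_ne_zero 2 hd)) (am_ne (pow_ne_zero 2 hq)), ← map_mul, ← map_mul,
    h3]

lemma D_div (p q : ℂ[X]) (hq : q ≠ 0) :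
    D (algebraMap ℂ[X] (RatFunc ℂ) p / algebraMap ℂ[X] (RatFunc ℂ) q) =
      algebraMap ℂ[X] (RatFunc ℂ) (X * (derivative p * q - p * derivative q)) /
        algebraMap ℂ[X] (RatFunc ℂ) (q ^ 2) :=
  D_of_eq _ p q hq rfl

lemma ex_div (f : RatFunc ℂ) : ∃ p q : ℂ[X], q ≠ 0 ∧
    f = algebraMap ℂ[X] (RatFunc ℂ) p / algebraMap ℂ[X] (RatFunc ℂ) q :=
  ⟨f.num, f.denom, f.denom_ne_zero, (RatFunc.num_div_denom f).symm⟩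

lemma D_mul (f g : RatFunc ℂ) : D (f * g) = D f * g + f * D g := by
  obtain ⟨p, q, hq, rfl⟩ := ex_div f
  obtain ⟨r, s, hs, rfl⟩ := ex_div g
  rw [div_mul_div_comm, ← map_mul, ← map_mul, D_div _ _ hq, D_div _ _ hs,
    D_div _ _ (mul_ne_zero hq hs)]
  simp only [derivative_mul, map_mul, map_sub, map_add, map_pow]
  have := am_ne hq
  have := am_ne hs
  field_simp
  ring

lemma D_add (f g : RatFunc ℂ) : D (f + g) = D f + D g := by
  obtain ⟨p, q, hq, rfl⟩ := ex_div f
  obtain ⟨r, s, hs, rfl⟩ := ex_div g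
  rw [div_add_div _ _ (am_ne hq) (am_ne hs), ← map_mul, ← map_mul, ← map_mul, ← map_add,
    D_div _ _ hq, D_div _ _ hs, D_div _ _ (mul_ne_zero hq hs)]
  simp only [derivative_mul, derivative_add, map_mul, map_sub, map_add, map_pow]
  have := am_ne hq
  have := am_ne hs
  field_simp
  ring

lemma D_C (c : ℂ) : D (RatFunc.C c) = 0 := by
  have := D_div (Polynomial.C c) 1 one_ne_zero
  simpa using this

lemma D_X : D RatFunc.X = RatFunc.X := by
  have := D_div X 1 one_ne_zero
  simpa using this

lemma D_zero : D 0 = 0 := by simpa using D_C 0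

lemma D_neg (f : RatFunc ℂ) : D (-f) = - D f := by
  have := D_add f (-f)
  rw [add_neg_cancel, D_zero] at this
  linear_combination -this

lemma D_sub (f g : RatFunc ℂ) : D (f - g) = D f - D g := by
  rw [sub_eq_add_neg, D_add, D_neg]; ring

lemma D_two : D 2 = 0 := by
  have := D_C 2
  rwa [map_ofNat] at this

lemma Le.dif {n : ℤ} {f : RatFunc ℂ} (h : Le n f) : Le n (D f) := by
  by_cases hf : f = 0
  · left; rw [hf, D_zero]
  have h1 := h.deg hf
  by_cases h0 : D f = 0
  · exact Or.inl h0
  right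
  refine le_trans ?_ h1
  unfold D at h0 ⊢
  set p := f.num with hp
  set q := f.denom with hq
  have hqne : q ≠ 0 := f.denom_ne_zero
  have hne : X * (derivative p * q - p * derivative q) ≠ 0 := by
    intro h; apply h0; rw [h]; simp
  rw [RatFunc.intDegree_div (am_ne hne) (am_ne (pow_ne_zero 2 hqne)),
    RatFunc.intDegree_polynomial, RatFunc.intDegree_polynomial, RatFunc.intDegree, natDegree_pow,
    ← hp, ← hq]
  have key : (X * (derivative p * q - p * derivative q)).natDegree ≤ p.natDegree + q.natDegree := by
    have e : X * (derivative p * q - p * derivative q) =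
        (X * derivative p) * q - p * (X * derivative q) := by ring
    have hX : ∀ r : ℂ[X], (X * derivative r).natDegree ≤ r.natDegree := by
      intro r
      by_cases hr : r.natDegree = 0
      · rw [natDegree_eq_zero.mp hr |>.choose_spec.symm]; simp
      · refine natDegree_mul_le.trans ?_
        have := natDegree_derivative_lt hr
        rw [natDegree_X]; omega
    rw [e]
    refine (natDegree_sub_le _ _).trans (max_le ?_ ?_)
    · exact natDegree_mul_le.trans (by have := hX p; omega)
    · exact natDegree_mul_le.trans (by have := hX q; omega)
  push_cast
  omega

section core

variable {a b : ℂ} {x u z w : RatFunc ℂ}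

lemma two_ne : (2 : RatFunc ℂ) ≠ 0 := two_ne_zero

/-- if `u` decays then so does `x` -/
lemma x_le (h2 : 2 * D u = RatFunc.C (-4) * (x * u * u) + x - RatFunc.C (4 * b) * u) {n : ℤ} (hn : 1 ≤ n)
    (hu : Le (-n) u) : Le (-n) x := by
  by_cases hx : x = 0
  · exact Or.inl hx
  right
  by_contra hlt
  push Not at hlt
  have e : x = 2 * D u - RatFunc.C (-4) * (x * u * u) + RatFunc.C (4 * b) * u := by
    rw [h2]; ring
  have : Le (x.intDegree - 1) x := by
    have h3 : Le (x.intDegree - 1) (2 * D u - RatFunc.C (-4) * (x * u * u) + RatFunc.C (4 * b) * u) := by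
      refine Le.add (Le.sub ?_ ?_) ?_
      · exact hu.dif.tmul.mono (by omega)
      · exact ((((Le.self x).mul hu).mul hu).cmul _).mono (by omega)
      · exact (hu.cmul _).mono (by omega)
    rwa [← e] at h3
  have := this.deg hx
  omega

lemma e_le {n : ℤ} (hn : 0 ≤ n) (hx : Le (-n) x) (hu : Le (-n) u) :
    Le (-n) (D x - RatFunc.C (2 * b) * x - 2 * (x * x * u)) := by
  refine Le.sub (Le.sub hx.dif (hx.cmul _)) ?_
  exact (((hx.mul hx).mul hu).tmul).mono (by omega)

/-- the contradiction used when `z` has nonpositive degree -/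
lemma caseB_aux (hz : z ≠ 0) (hN : z.intDegree ≤ 0)
    (h3 : D z = 2 * (z * z * (u + w)) + RatFunc.C (1 - 2 * a) * z + RatFunc.X)
    (h4 : D w = 2 * (z * (u * u)) - 2 * (z * ((u + w) * (u + w))) - RatFunc.C (1 - 2 * a) * w
      + RatFunc.C (2 * a) * u)
    (hm : Le 0 (z * z * u)) : False := by
  have hzN := Le.self z
  have hv := Le.inv z
  set N := z.intDegree
  set s := u + w with hs
  have hw : w = s - u := by rw [hs]; ring
  rw [hw, D_sub] at h4
  have hr0 : Le 0 (2 * (z * z * s) + RatFunc.X) := by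
    have : 2 * (z * z * s) + RatFunc.X = D z - RatFunc.C (1 - 2 * a) * z := by rw [h3]; ring
    rw [this]
    exact (hzN.dif.sub (hzN.cmul _)).mono hN
  set r := z * z * s with hr
  have hr1 : Le 1 r := by
    apply Le.of_tmul
    have : 2 * r = (2 * r + RatFunc.X) - RatFunc.X := by ring
    rw [this]
    exact (hr0.mono (by omega)).sub Le.tX
  have hsr : s = r * z⁻¹ * z⁻¹ := by rw [hr]; field_simp
  have hum : u = (z * z * u) * z⁻¹ * z⁻¹ := by field_simp
  have hsl : Le (1 - 2 * N) s := by
    rw [hsr]; exact ((hr1.mul hv).mul hv).mono (by omega)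
  have hul : Le (- 2 * N) u := by
    rw [hum]; exact ((hm.mul hv).mul hv).mono (by omega)
  have hul' : Le (1 - 2 * N) u := hul.mono (by omega)
  have hz3 : Le (3 * N) (z * z * z) := ((hzN.mul hzN).mul hzN).mono (by omega)
  have e1 : 2 * (r * r) = 2 * ((z * z * u) * (z * z * u)) -
      (z * z * z) * (D s - D u + RatFunc.C (1 - 2 * a) * (s - u) - RatFunc.C (2 * a) * u) := by
    rw [h4, hr]; ring
  have hrr : Le 1 (2 * (r * r)) := by
    rw [e1]
    refine Le.sub ((hm.mul hm).tmul.mono (by omega)) ?_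
    refine (hz3.mul (n := 1 - 2 * N) ?_).mono (by omega)
    exact ((hsl.dif.sub hul'.dif).add ((hsl.sub hul').cmul _)).sub (hul'.cmul _)
  have e2 : RatFunc.X * RatFunc.X = 2 * (2 * (r * r)) + (2 * r + RatFunc.X) * (RatFunc.X - 2 * r) := by ring
  have : Le 1 (RatFunc.X * RatFunc.X) := by
    rw [e2]
    refine hrr.tmul.add ?_
    exact (hr0.mul (Le.tX.sub hr1.tmul)).mono (by omega)
  have := this.deg (mul_ne_zero RatFunc.X_ne_zero RatFunc.X_ne_zero)
  rw [RatFunc.intDegree_mul RatFunc.X_ne_zero RatFunc.X_ne_zero, RatFunc.intDegree_X] at this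
  omega

lemma caseB (hz : z ≠ 0) (hN : z.intDegree ≤ 0)
    (h1 : D x = 2 * (x * x * u) + RatFunc.C (2 * b) * x - RatFunc.C (2 * a) * z
      + 2 * (z * z * w) + RatFunc.X)
    (h2 : 2 * D u = RatFunc.C (-4) * (x * u * u) + x - RatFunc.C (4 * b) * u)
    (h3 : D z = 2 * (z * z * (u + w)) + RatFunc.C (1 - 2 * a) * z + RatFunc.X)
    (h4 : D w = 2 * (z * (u * u)) - 2 * (z * ((u + w) * (u + w))) - RatFunc.C (1 - 2 * a) * w
      + RatFunc.C (2 * a) * u) : False := by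
  have hzN := Le.self z
  apply caseB_aux hz hN h3 h4
  by_cases hu : Le 0 u
  · exact ((hzN.mul hzN).mul hu).mono (by omega)
  have hu0 : u ≠ 0 := fun h => hu (Or.inl h)
  have hU : 1 ≤ u.intDegree := by
    by_contra h
    exact hu (Or.inr (by omega))
  have huU := Le.self u
  set U := u.intDegree with hUdef
  have hxU : Le (-U) x := by
    by_cases hx : x = 0
    · exact Or.inl hx
    right
    by_contra hlt
    push Not at hlt
    have hxX := Le.self x
    have e : x * u * u = RatFunc.C (-1/4) * (2 * D u - x + RatFunc.C (4 * b) * u) := by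
      rw [h2]
      have : RatFunc.C (-1/4 : ℂ) * RatFunc.C (-4) = 1 := by
        rw [← map_mul]; norm_num
      linear_combination (- (x * u * u)) * this
    have h5 : Le (max x.intDegree U) (x * u * u) := by
      rw [e]
      refine Le.cmul _ ((Le.sub (huU.dif.tmul.mono (le_max_right _ _))
        (hxX.mono (le_max_left _ _))).add ((huU.cmul _).mono (le_max_right _ _)))
    have h6 := h5.deg (mul_ne_zero (mul_ne_zero hx hu0) hu0)
    rw [RatFunc.intDegree_mul (mul_ne_zero hx hu0) hu0, RatFunc.intDegree_mul hx hu0] at h6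
    omega
  have hq : Le 0 (2 * (z * z * w) + RatFunc.X) := by
    have : 2 * (z * z * w) + RatFunc.X =
      D x - RatFunc.C (2 * b) * x - 2 * (x * x * u) + RatFunc.C (2 * a) * z := by
      rw [h1]; ring
    rw [this]
    refine Le.add (Le.sub (Le.sub (hxU.dif.mono (by omega)) ((hxU.cmul _).mono (by omega))) ?_)
      ((hzN.cmul _).mono hN)
    exact (((hxU.mul hxU).mul huU).tmul).mono (by omega)
  apply Le.of_tmul
  have : 2 * (z * z * u) = D z - RatFunc.C (1 - 2 * a) * z - (2 * (z * z * w) + RatFunc.X) := by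
    rw [h3]; ring
  rw [this]
  exact ((hzN.dif.sub (hzN.cmul _)).mono hN).sub hq

lemma caseA (ha : a ≠ 0) (hz : z ≠ 0) (hN : 1 ≤ z.intDegree)
    (h1 : D x = 2 * (x * x * u) + RatFunc.C (2 * b) * x - RatFunc.C (2 * a) * z
      + 2 * (z * z * w) + RatFunc.X)
    (h2 : 2 * D u = RatFunc.C (-4) * (x * u * u) + x - RatFunc.C (4 * b) * u)
    (h3 : D z = 2 * (z * z * (u + w)) + RatFunc.C (1 - 2 * a) * z + RatFunc.X)
    (h4 : D w = 2 * (z * (u * u)) - 2 * (z * ((u + w) * (u + w))) - RatFunc.C (1 - 2 * a) * w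
      + RatFunc.C (2 * a) * u) :
    x = 0 ∧ u = 0 ∧ z * RatFunc.C (2 * a) = RatFunc.X ∧ w = 0 := by
  have hzN := Le.self z
  have hv := Le.inv z
  have huN : Le (- z.intDegree) u := by
    by_cases hu : u = 0
    · exact Or.inl hu
    right
    by_contra hlt
    push Not at hlt
    have huU := Le.self u
    set N := z.intDegree
    set s := u + w with hs
    have hsN : Le (-N) s := by
      apply Le.of_tmul
      have : 2 * s = (D z - RatFunc.C (1 - 2 * a) * z - RatFunc.X) * z⁻¹ * z⁻¹ := by
        rw [h3]; field_simp; ring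
      rw [this]
      refine ((Le.mul (m := N) ?_ hv).mul hv).mono (by omega)
      exact ((hzN.dif.sub (hzN.cmul _)).sub (Le.tX.mono hN))
    have hw : w = s - u := by rw [hs]; ring
    rw [hw, D_sub] at h4
    have e : 2 * (z * (u * u)) = D s - D u + 2 * (z * (s * s)) + RatFunc.C (1 - 2 * a) * (s - u)
        - RatFunc.C (2 * a) * u := by rw [h4]; ring
    have hsU : Le u.intDegree s := hsN.mono hlt.le
    have h5 : Le u.intDegree (z * (u * u)) := by
      apply Le.of_tmul
      rw [e]
      refine (((hsU.dif.sub huU.dif).add ?_).add ((hsU.sub huU).cmul _)).sub (huU.cmul _)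
      exact (hzN.mul (hsN.mul hsN)).tmul.mono (by omega)
    have h6 := h5.deg (mul_ne_zero hz (mul_ne_zero hu hu))
    rw [RatFunc.intDegree_mul hz (mul_ne_zero hu hu), RatFunc.intDegree_mul hu hu] at h6
    omega
  set e := D x - RatFunc.C (2 * b) * x - 2 * (x * x * u) with he
  have hel : ∀ n : ℤ, 1 ≤ n → Le (-n) u → Le (-n) e := fun n hn hu =>
    e_le (by omega) (x_le h2 hn hu) hu
  set v := z⁻¹ with hvdef
  have hzv : z * v = 1 := mul_inv_cancel₀ hz
  have hDv : D v = - D z * (v * v) := by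
    have := D_mul z v
    rw [hzv] at this
    have h1 : D 1 = 0 := by simpa using D_C 1
    rw [h1] at this
    linear_combination (-v) * this - (D v) * hzv
  have hC2 : ∀ c : ℂ, RatFunc.C (2 * c) = 2 * RatFunc.C c := by
    intro c; rw [map_mul, map_ofNat]
  have hC12 : RatFunc.C (1 - 2 * a) = 1 - 2 * RatFunc.C a := by
    rw [map_sub, hC2, map_one]
  have hw2 : 2 * w = 2 * RatFunc.C a * v - RatFunc.X * (v * v) + e * (v * v) := by
    have e1 : e = - RatFunc.C (2 * a) * z + 2 * (z * z * w) + RatFunc.X := by rw [he, h1]; ring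
    rw [e1, hC2, hvdef]; field_simp; ring
  have hu2 : 2 * u = - D v - v - e * (v * v) := by
    have e1 : e = - RatFunc.C (2 * a) * z + 2 * (z * z * w) + RatFunc.X := by rw [he, h1]; ring
    rw [hDv, h3, e1, hC2, hC12, hvdef]; field_simp; ring
  have key : RatFunc.X * (RatFunc.X * v - RatFunc.C (2 * a)) = e + e * e * v - D e := by
    have h5 : D (2 * w) = 2 * RatFunc.C a * D v - RatFunc.X * (v * v) - 2 * (RatFunc.X * v * D v)
        + D e * (v * v) + 2 * (e * v * D v) := by
      rw [hw2]
      simp only [D_add, D_sub, D_mul, D_X, D_C, D_two]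
      ring
    rw [D_mul, D_two, h4] at h5
    have hvne : v ≠ 0 := inv_ne_zero hz
    have hw3 : w = (2 * RatFunc.C a * v - RatFunc.X * (v * v) + e * (v * v)) / 2 := by
      rw [← hw2]; field_simp
    have hu3 : u = (- D v - v - e * (v * v)) / 2 := by
      rw [← hu2]; field_simp
    have hz3 : z = 1 / v := by rw [hvdef]; simp
    rw [hC12, hC2] at h5
    rw [hC2]
    generalize D v = dv at *
    generalize D e = de at *
    rw [hw3, hu3, hz3] at h5
    clear_value e v
    clear h1 h2 h3 h4 hw2 hu2 hw3 hu3 hDv hzv hzN hv huN hel hz3 hvdef he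
    field_simp at h5
    apply mul_left_cancel₀ (pow_ne_zero 3 hvne)
    linear_combination (-1/2) * h5
  have hdel : ∀ n : ℤ, 1 ≤ n → Le (-n) u → Le (-n - 1) (RatFunc.X * v - RatFunc.C (2 * a)) := by
    intro n hn hu
    have hen := hel n hn hu
    have h5 : Le (-n) (RatFunc.X * (RatFunc.X * v - RatFunc.C (2 * a))) := by
      rw [key]
      exact (hen.add (((hen.mul hen).mul hv).mono (by omega))).sub hen.dif
    by_cases h0 : RatFunc.X * v - RatFunc.C (2 * a) = 0
    · exact Or.inl h0
    right
    have h6 := h5.deg (mul_ne_zero RatFunc.X_ne_zero h0)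
    rw [RatFunc.intDegree_mul RatFunc.X_ne_zero h0, RatFunc.intDegree_X] at h6
    omega
  have hN1 : z.intDegree = 1 := by
    by_contra hne
    have h5 : Le (-1) (RatFunc.X * v) := (Le.tX.mul hv).mono (by omega)
    have h6 : Le (-1) (RatFunc.C (2 * a)) := by
      have : RatFunc.C (2 * a) = RatFunc.X * v - (RatFunc.X * v - RatFunc.C (2 * a)) := by ring
      rw [this]
      exact h5.sub ((hdel _ hN huN).mono (by omega))
    have hne : RatFunc.C (2 * a) ≠ 0 := by
      rw [Ne, map_eq_zero]; exact mul_ne_zero two_ne_zero ha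
    have := h6.deg hne
    rw [RatFunc.intDegree_C] at this
    omega
  rw [hN1] at huN hv
  have hall : ∀ n : ℕ, Le (-((n : ℤ) + 1)) u := by
    intro n
    induction n with
    | zero => exact huN.mono (by simp)
    | succ n ih =>
      have h5 := hdel _ (by omega) ih
      have h6 := hel _ (by omega) ih
      apply Le.of_tmul
      have e1 : RatFunc.X * (2 * u) = - D (RatFunc.X * v - RatFunc.C (2 * a)) - RatFunc.X * (e * (v * v)) := by
        rw [hu2]
        simp only [D_sub, D_mul, D_X, D_C]
        ring
      have h7 : Le (-((n : ℤ) + 1) - 1) (RatFunc.X * (2 * u)) := by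
        rw [e1]
        exact h5.dif.neg.sub ((Le.tX.mul (h6.mul (hv.mul hv))).mono (by omega))
      by_cases h0 : 2 * u = 0
      · exact Or.inl h0
      right
      have h8 := h7.deg (mul_ne_zero RatFunc.X_ne_zero h0)
      rw [RatFunc.intDegree_mul RatFunc.X_ne_zero h0, RatFunc.intDegree_X] at h8
      push_cast
      omega
  have hu0 : u = 0 := Le.eq_zero (fun n => (hall n).mono (by omega))
  have hx0 : x = 0 := by
    rw [hu0, D_zero] at h2
    linear_combination -h2
  have he0 : e = 0 := by rw [he, hx0, D_zero]; ring
  have hd0 : RatFunc.X * v = RatFunc.C (2 * a) := by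
    rw [he0, D_zero] at key
    have : RatFunc.X * (RatFunc.X * v - RatFunc.C (2 * a)) = 0 := by rw [key]; ring
    exact sub_eq_zero.mp ((mul_eq_zero.mp this).resolve_left RatFunc.X_ne_zero)
  refine ⟨hx0, hu0, ?_, ?_⟩
  · rw [← hd0]; linear_combination RatFunc.X * hzv
  · rw [he0] at hw2
    rw [hC2] at hd0
    have : 2 * w = 0 := by rw [hw2]; linear_combination (-v) * hd0
    exact (mul_eq_zero.mp this).resolve_left two_ne

/-- uniqueness for the shifted system over the field of rational functions -/
theorem core_unique (ha : a ≠ 0)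
    (h1 : D x = 2 * (x * x * u) + RatFunc.C (2 * b) * x - RatFunc.C (2 * a) * z
      + 2 * (z * z * w) + RatFunc.X)
    (h2 : 2 * D u = RatFunc.C (-4) * (x * u * u) + x - RatFunc.C (4 * b) * u)
    (h3 : D z = 2 * (z * z * (u + w)) + RatFunc.C (1 - 2 * a) * z + RatFunc.X)
    (h4 : D w = 2 * (z * (u * u)) - 2 * (z * ((u + w) * (u + w))) - RatFunc.C (1 - 2 * a) * w
      + RatFunc.C (2 * a) * u) :
    x = 0 ∧ u = 0 ∧ z * RatFunc.C (2 * a) = RatFunc.X ∧ w = 0 := by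
  have hz : z ≠ 0 := by
    intro h
    rw [h, D_zero] at h3
    apply RatFunc.X_ne_zero (K := ℂ)
    linear_combination -h3
  rcases le_or_gt z.intDegree 0 with h | h
  · exact (caseB hz h h1 h2 h3 h4).elim
  · exact caseA ha hz h h1 h2 h3 h4

end core

/-- `f` agrees with the rational function `F` off a finite set -/
def Rep (f : ℂ → ℂ) (F : RatFunc ℂ) : Prop :=
  ∃ p q : ℂ[X], q ≠ 0 ∧ F = algebraMap ℂ[X] (RatFunc ℂ) p / algebraMap ℂ[X] (RatFunc ℂ) q ∧
    ∀ᶠ t in cofinite, f t = p.eval t / q.eval t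

lemma ev_ne {q : ℂ[X]} (hq : q ≠ 0) : ∀ᶠ t in cofinite, q.eval t ≠ 0 := by
  have : {t : ℂ | q.eval t = 0}.Finite := by
    have := q.rootSet_finite ℂ
    refine this.subset ?_
    intro t ht
    rw [mem_rootSet]
    exact ⟨hq, by simpa using ht⟩
  simpa [Filter.eventually_cofinite] using this

lemma Rep.const (c : ℂ) : Rep (fun _ => c) (RatFunc.C c) :=
  ⟨Polynomial.C c, 1, one_ne_zero, by simp, by simp⟩

lemma Rep.id : Rep (fun t => t) RatFunc.X :=
  ⟨X, 1, one_ne_zero, by simp, by simp⟩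

lemma Rep.add {f g : ℂ → ℂ} {F G : RatFunc ℂ} (hf : Rep f F) (hg : Rep g G) :
    Rep (fun t => f t + g t) (F + G) := by
  obtain ⟨p, q, hq, rfl, h⟩ := hf
  obtain ⟨r, s, hs, rfl, h'⟩ := hg
  refine ⟨p * s + q * r, q * s, mul_ne_zero hq hs, ?_, ?_⟩
  · rw [div_add_div _ _ (am_ne hq) (am_ne hs)]; simp
  · filter_upwards [h, h', ev_ne hq, ev_ne hs] with t h1 h2 h3 h4
    rw [h1, h2, div_add_div _ _ h3 h4]; simp

lemma Rep.mul {f g : ℂ → ℂ} {F G : RatFunc ℂ} (hf : Rep f F) (hg : Rep g G) :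
    Rep (fun t => f t * g t) (F * G) := by
  obtain ⟨p, q, hq, rfl, h⟩ := hf
  obtain ⟨r, s, hs, rfl, h'⟩ := hg
  refine ⟨p * r, q * s, mul_ne_zero hq hs, ?_, ?_⟩
  · rw [div_mul_div_comm]; simp
  · filter_upwards [h, h'] with t h1 h2
    rw [h1, h2, div_mul_div_comm]; simp

lemma Rep.sub {f g : ℂ → ℂ} {F G : RatFunc ℂ} (hf : Rep f F) (hg : Rep g G) :
    Rep (fun t => f t - g t) (F - G) := by
  have := hf.add ((Rep.const (-1)).mul hg)
  simpa [sub_eq_add_neg] using this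

lemma Rep.dif {f : ℂ → ℂ} {F : RatFunc ℂ} (hf : Rep f F) :
    Rep (fun t => t * deriv f t) (D F) := by
  obtain ⟨p, q, hq, rfl, h⟩ := hf
  refine ⟨_, _, pow_ne_zero 2 hq, D_div p q hq, ?_⟩
  have h' : ∀ᶠ t in cofinite, f =ᶠ[𝓝 t] fun t => p.eval t / q.eval t := by
    rw [Filter.eventually_cofinite] at h
    filter_upwards [h.compl_mem_cofinite] with t ht
    filter_upwards [h.isClosed.isOpen_compl.mem_nhds ht] with y hy
    simpa using hy
  filter_upwards [h', ev_ne hq] with t h1 h2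
  rw [h1.deriv_eq, ((p.hasDerivAt t).fun_div (q.hasDerivAt t) h2).deriv]
  simp
  ring

lemma Rep.eq {f g : ℂ → ℂ} {F G : RatFunc ℂ} (hf : Rep f F) (hg : Rep g G)
    (h : ∀ᶠ t in cofinite, f t = g t) : F = G := by
  obtain ⟨p, q, hq, rfl, h1⟩ := hf
  obtain ⟨r, s, hs, rfl, h2⟩ := hg
  rw [div_eq_div_iff (am_ne hq) (am_ne hs), ← map_mul, ← map_mul]
  congr 1
  apply Polynomial.eq_of_infinite_eval_eq
  have : ∀ᶠ t in cofinite, eval t (p * s) = eval t (r * q) := by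
    filter_upwards [h, h1, h2, ev_ne hq, ev_ne hs] with t h3 h4 h5 h6 h7
    rw [h4, h5, div_eq_div_iff h6 h7] at h3
    simpa using h3
  exact Filter.frequently_cofinite_iff_infinite.mp this.frequently

lemma Rep.ev_eq {f g : ℂ → ℂ} {F : RatFunc ℂ} (hf : Rep f F) (hg : Rep g F) :
    ∀ᶠ t in cofinite, f t = g t := by
  obtain ⟨p, q, hq, rfl, h1⟩ := hf
  obtain ⟨r, s, hs, e, h2⟩ := hg
  rw [div_eq_div_iff (am_ne hq) (am_ne hs), ← map_mul, ← map_mul] at e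
  have e := RatFunc.algebraMap_injective ℂ e
  filter_upwards [h1, h2, ev_ne hq, ev_ne hs] with t h4 h5 h6 h7
  rw [h4, h5, div_eq_div_iff h6 h7, ← eval_mul, ← eval_mul, e]

lemma IsRatFn.rep {f : ℂ → ℂ} (h : IsRatFn f) : ∃ F, Rep f F := by
  obtain ⟨p, q, hq, h⟩ := h
  exact ⟨_, p, q, hq, rfl, Filter.Eventually.of_forall h⟩

end B4aux

/-- When `α₀ - α₁ = 0`, `α₃ + α₄ = 0` and `α₄ ≠ 0`, the quadruple
`(0, 1/2, t/(2α₄), 0)` is a rational solution of the Sasano system `B₄⁽¹⁾`, and every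
rational solution coincides with it (as rational functions, i.e. off a finite set). -/
theorem B4_unique_rational_solution (a0 a1 a2 a3 a4 : ℂ)
    (hsum : a0 + a1 + 2*a2 + 2*a3 + 2*a4 = 1)
    (h01 : a0 - a1 = 0) (h34 : a3 + a4 = 0) (h4 : a4 ≠ 0) :
    IsRatSolB4 a0 a1 a2 a3 a4
      (fun _ => 0) (fun _ => 1/2) (fun t => t / (2*a4)) (fun _ => 0) ∧
    ∀ x y z w : ℂ → ℂ, IsRatSolB4 a0 a1 a2 a3 a4 x y z w →
      ∃ S : Set ℂ, S.Finite ∧ ∀ t ∉ S,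
        x t = 0 ∧ y t = 1/2 ∧ z t = t / (2*a4) ∧ w t = 0 := by
  have h3 : a3 = -a4 := by linear_combination h34
  have h0 : a0 = a1 := by linear_combination h01
  have h2 : a2 = 1/2 - a1 := by rw [h0, h3] at hsum; linear_combination hsum / 2
  subst h3 h0 h2
  constructor
  · refine ⟨⟨0, 1, one_ne_zero, by simp⟩, ⟨Polynomial.C (1/2), 1, one_ne_zero, by simp⟩,
      ⟨X, Polynomial.C (2 * a4), ?_, by simp⟩, ⟨0, 1, one_ne_zero, by simp⟩, ∅,
      Set.finite_empty, ?_⟩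
    · rw [Ne, Polynomial.C_eq_zero]; exact mul_ne_zero two_ne_zero h4
    · intro t _
      have hd : deriv (fun t : ℂ => t / (2 * a4)) t = 1 / (2 * a4) := by
        simp
      refine ⟨?_, ?_, ?_, ?_⟩
      · simp only [deriv_const]; field_simp; ring
      · simp only [deriv_const]; ring
      · rw [hd]; field_simp; ring
      · simp only [deriv_const]; ring
  · rintro x y z w ⟨hx, hy, hz, hw, S, hS, hE⟩
    obtain ⟨x', hx⟩ := B4aux.IsRatFn.rep hx
    obtain ⟨y', hy⟩ := B4aux.IsRatFn.rep hy
    obtain ⟨z', hz⟩ := B4aux.IsRatFn.rep hz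
    obtain ⟨w', hw⟩ := B4aux.IsRatFn.rep hw
    have hE' : ∀ᶠ t in cofinite, B4Eqs a0 a0 (1/2 - a0) (-a4) a4 x y z w t := by
      filter_upwards [hS.compl_mem_cofinite] with t ht using hE t ht
    have hu := hy.sub (B4aux.Rep.const (1/2))
    set u' := y' - RatFunc.C (1/2) with hu'
    have hDu : B4aux.D u' = B4aux.D y' := by rw [hu', B4aux.D_sub, B4aux.D_C, sub_zero]
    have c2 := B4aux.Rep.const 2
    rw [map_ofNat] at c2
    have cc := fun c => B4aux.Rep.const c
    have ht := B4aux.Rep.id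
    have key := B4aux.core_unique (a := a4) (b := a0) (x := x') (u := u') (z := z') (w := w') h4
      (by
        refine hx.dif.eq ((((c2.mul ((hx.mul hx).mul hu)).add ((cc _).mul hx)).sub
          ((cc _).mul hz)).add (c2.mul ((hz.mul hz).mul hw)) |>.add ht) ?_
        filter_upwards [hE'] with t h
        rw [h.1]; ring)
      (by
        rw [hDu]
        refine (c2.mul hy.dif).eq ((((cc _).mul ((hx.mul hu).mul hu)).add hx).sub
          ((cc _).mul hu)) ?_
        filter_upwards [hE'] with t h
        rw [h.2.1]; ring)
      (by
        refine hz.dif.eq (((c2.mul ((hz.mul hz).mul (hu.add hw))).add ((cc _).mul hz)).add ht) ?_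
        filter_upwards [hE'] with t h
        rw [h.2.2.1]; ring)
      (by
        refine hw.dif.eq ((((c2.mul (hz.mul (hu.mul hu))).sub
          (c2.mul (hz.mul ((hu.add hw).mul (hu.add hw))))).sub ((cc _).mul hw)).add
          ((cc _).mul hu)) ?_
        filter_upwards [hE'] with t h
        rw [h.2.2.2]; ring)
    obtain ⟨k1, k2, k3, k4⟩ := key
    have c0 := cc 0
    rw [map_zero] at c0
    rw [k1] at hx
    rw [k2] at hu
    rw [k4] at hw
    have hz2 := hz.mul (cc (2 * a4))
    rw [k3] at hz2
    have hfin := (((hx.ev_eq c0).and (hu.ev_eq c0)).and (hz2.ev_eq ht)).and (hw.ev_eq c0)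
    refine ⟨_, Filter.eventually_cofinite.mp hfin, ?_⟩
    intro t ht
    simp only [Set.mem_ofPred_eq, not_not] at ht
    obtain ⟨⟨⟨g1, g2⟩, g3⟩, g4⟩ := ht
    refine ⟨g1, by linear_combination g2, ?_, g4⟩
    rw [eq_div_iff (mul_ne_zero two_ne_zero h4)]
    exact g3
end
end

section
/- Let α0,α1,α2,α3,α4 be complex numbers with α0+α1+2α2+2α3+2α4=1. Suppose (x1,y1,z1,w1) and (x2,y2,z2,w2) are two solutions of the Sasano system B4(α0,α1,α2,α3,α4), each defined on some annulus {|t|>R}, such that in each solution z has a pole of order exactly one at t=∞ and x, y, w are holomorphic at t=∞. Then the two solutions coincide on a neighborhood of t=∞, i.e., x1=x2, y1=y2, z1=z2, w1=w2 for all t of sufficiently large modulus. -/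
open Filter Topology Polynomial

noncomputable section

/-- `(x,y,z,w)` is a holomorphic solution of the Sasano system `B₄⁽¹⁾` on the set `s`. -/
def SolvesB4On (a0 a1 a2 a3 a4 : ℂ) (x y z w : ℂ → ℂ) (s : Set ℂ) : Prop :=
  ∀ t ∈ s, DifferentiableAt ℂ x t ∧ DifferentiableAt ℂ y t ∧
    DifferentiableAt ℂ z t ∧ DifferentiableAt ℂ w t ∧ B4Eqs a0 a1 a2 a3 a4 x y z w t

/-- The filter of neighbourhoods of `t = ∞` in `ℂ`. -/
def atInfty : Filter ℂ := Filter.comap (fun t : ℂ => ‖t‖) Filter.atTop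

/-- `f` is holomorphic at `t = ∞`: `f(t)` has a finite limit as `t → ∞`. -/
def HoloAtInfty (f : ℂ → ℂ) : Prop := ∃ L : ℂ, Tendsto f atInfty (𝓝 L)

/-- `f` has a pole of order `n ≥ 1` at `t = ∞`: `t⁻ⁿ·f(t)` has a finite nonzero limit
as `t → ∞`. -/
def PoleAtInftyOfOrder (f : ℂ → ℂ) (n : ℕ) : Prop :=
  ∃ L : ℂ, L ≠ 0 ∧ Tendsto (fun t => f t / t ^ n) atInfty (𝓝 L)

lemma ext_aux (f : ℂ → ℂ) (R : ℝ) (L : ℂ) (hf : ∀ t : ℂ, R < ‖t‖ → DifferentiableAt ℂ f t)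
    (hL : Tendsto f atInfty (𝓝 L)) :
    ∃ g : ℂ → ℂ, AnalyticAt ℂ g 0 ∧ g 0 = L ∧ ∀ᶠ s in 𝓝[≠] (0:ℂ), g s = f s⁻¹ ∧
      s⁻¹ * deriv f s⁻¹ = - (s * deriv g s) := by
  have hinf : Tendsto (fun s : ℂ => s⁻¹) (𝓝[≠] 0) atInfty := by
    unfold atInfty
    rw [comap_norm_atTop]
    exact Filter.tendsto_inv₀_nhdsNE_zero
  have hR : ∀ᶠ s in 𝓝[≠] (0:ℂ), R < ‖s⁻¹‖ := by
    have : ∀ᶠ t in atInfty, R < ‖t‖ := (tendsto_comap).eventually (eventually_gt_atTop R)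
    exact hinf.eventually this
  set g : ℂ → ℂ := Function.update (fun s => f s⁻¹) 0 L with hg
  have hgne : ∀ s : ℂ, s ≠ 0 → g s = f s⁻¹ := fun s hs => by simp [hg, hs]
  have hge : ∀ s : ℂ, s ≠ 0 → g =ᶠ[𝓝 s] (fun s => f s⁻¹) := fun s hs => by
    filter_upwards [isOpen_ne.mem_nhds hs] with r hr using hgne r hr
  have hda : ∀ s : ℂ, s ≠ 0 → R < ‖s⁻¹‖ → HasDerivAt g (deriv f s⁻¹ * (-(s^2)⁻¹)) s := by
    intro s hs hRs
    have := (hf _ hRs).hasDerivAt.comp s (hasDerivAt_inv hs)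
    exact this.congr_of_eventuallyEq (hge s hs)
  refine ⟨g, ?_, by simp [hg], ?_⟩
  · apply Complex.analyticAt_of_differentiable_on_punctured_nhds_of_continuousAt
    · filter_upwards [hR, self_mem_nhdsWithin] with s hs h0
      exact (hda s h0 hs).differentiableAt
    · exact continuousAt_update_same.2 (hL.comp hinf)
  · filter_upwards [hR, self_mem_nhdsWithin] with s hs h0
    have h0' : s ≠ 0 := h0
    refine ⟨hgne s h0, ?_⟩
    rw [(hda s h0 hs).deriv]
    field_simp

lemma div_aux (g : ℂ → ℂ) (hg : AnalyticAt ℂ g 0) (c : ℂ) (h0 : g 0 = c) :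
    ∃ h : ℂ → ℂ, AnalyticAt ℂ h 0 ∧ ∀ s, g s = c + s * h s := by
  refine ⟨dslope g 0, ?_, ?_⟩
  · obtain ⟨p, hp⟩ := hg
    exact ⟨_, hp.has_fpower_series_dslope_fslope⟩
  · intro s
    have := sub_smul_dslope g 0 s
    simp only [sub_zero, smul_eq_mul] at this
    rw [this, h0]; ring

lemma lim_aux (F : ℂ → ℂ) (hF : AnalyticAt ℂ F 0) (h : ∀ᶠ s in 𝓝[≠] (0:ℂ), F s = 0) :
    F 0 = 0 := by
  have h1 : Tendsto F (𝓝[≠] 0) (𝓝 (F 0)) := hF.continuousAt.tendsto.mono_left nhdsWithin_le_nhds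
  have h2 : Tendsto F (𝓝[≠] 0) (𝓝 0) := (tendsto_congr' h).2 tendsto_const_nhds
  exact tendsto_nhds_unique h1 h2

/-- The regularised system at infinity, in the coordinate `s = 1/t`. -/
structure Red (a1 a3 a4 c : ℂ) (X q u v : ℂ → ℂ) : Prop where
  hX : AnalyticAt ℂ X 0
  hq : AnalyticAt ℂ q 0
  hu : AnalyticAt ℂ u 0
  hv : AnalyticAt ℂ v 0
  u0 : u 0 ≠ 0
  eqs : ∀ᶠ s in 𝓝[≠] (0:ℂ),
    (2 * a3 * u s + 2 * u s ^ 2 * v s + 1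
      = s * (-(s * deriv X s) - c * X s - 2 * s * X s ^ 2 * q s)) ∧
    (s * (-(s * deriv q s) - q s)
      = 2 * X s * (1/4 - s^2 * q s ^ 2) - c * (1/2 + s * q s) + a1) ∧
    (-(s * deriv u s) = 2 * u s ^ 2 * v s + 2 * u s ^ 2 * q s - 2 * a4 * u s + 1) ∧
    (-(s * deriv v s) = -2 * u s * v s ^ 2 + 2 * a4 * v s - 2 * a3 * q s - 4 * q s * u s * v s)

lemma deriv_aux (g h : ℂ → ℂ) (hh : AnalyticAt ℂ h 0) (c : ℂ) (H : ∀ s, g s = c + s * h s) :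
    ∀ᶠ s in 𝓝[≠] (0:ℂ), deriv g s = h s + s * deriv h s := by
  have : ∀ᶠ s in 𝓝 (0:ℂ), AnalyticAt ℂ h s := hh.eventually_analyticAt
  filter_upwards [nhdsWithin_le_nhds this] with s hs
  have e : g = fun s => c + s * h s := funext H
  have := (((hasDerivAt_id s).mul hs.differentiableAt.hasDerivAt).const_add c).deriv
  rw [e]
  simpa using this

lemma red_exists (a0 a1 a2 a3 a4 : ℂ) (R : ℝ) (x y z w : ℂ → ℂ)
    (hsol : SolvesB4On a0 a1 a2 a3 a4 x y z w {t : ℂ | R < ‖t‖})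
    (hz : PoleAtInftyOfOrder z 1) (hx : HoloAtInfty x) (hy : HoloAtInfty y)
    (hw : HoloAtInfty w) :
    ∃ X q u v : ℂ → ℂ, Red a1 a3 a4 (1 - 2*a2 - 2*a3 - 2*a4) X q u v ∧
      ∀ᶠ s in 𝓝[≠] (0:ℂ), x s⁻¹ = X s ∧ y s⁻¹ = 1/2 + s * q s ∧ z s⁻¹ = u s / s ∧
        w s⁻¹ = s * v s := by
  set c := 1 - 2*a2 - 2*a3 - 2*a4 with hc
  obtain ⟨Lx, hx⟩ := hx
  obtain ⟨Ly, hy⟩ := hy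
  obtain ⟨Lw, hw⟩ := hw
  obtain ⟨Lz, hLz, hz⟩ := hz
  obtain ⟨X, hXa, -, hX⟩ := ext_aux x R Lx (fun t ht => (hsol t ht).1) hx
  obtain ⟨Y, hYa, hY0, hY⟩ := ext_aux y R Ly (fun t ht => (hsol t ht).2.1) hy
  obtain ⟨W, hWa, hW0, hW⟩ := ext_aux w R Lw (fun t ht => (hsol t ht).2.2.2.1) hw
  obtain ⟨u, hua, hu0, hu⟩ := ext_aux (fun t => z t / t ^ 1) (max R 0) Lz (fun t ht => by
    have h0 : t ≠ 0 := norm_pos_iff.1 (lt_of_le_of_lt (le_max_right _ _) ht)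
    exact (hsol t (lt_of_le_of_lt (le_max_left _ _) ht)).2.2.1.div (by fun_prop)
      (pow_ne_zero _ h0)) hz
  have hinf : Tendsto (fun s : ℂ => s⁻¹) (𝓝[≠] 0) atInfty := by
    unfold atInfty
    rw [comap_norm_atTop]
    exact Filter.tendsto_inv₀_nhdsNE_zero
  have hR : ∀ᶠ s in 𝓝[≠] (0:ℂ), R < ‖s⁻¹‖ := by
    have : ∀ᶠ t in atInfty, R < ‖t‖ := (tendsto_comap).eventually (eventually_gt_atTop R)
    exact hinf.eventually this
  have hXd := hXa.deriv
  have hYd := hYa.deriv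
  have hWd := hWa.deriv
  have hud := hua.deriv
  -- equations in the coordinate s
  have E : ∀ᶠ s in 𝓝[≠] (0:ℂ), s ≠ 0 ∧
      (x s⁻¹ = X s ∧ y s⁻¹ = Y s ∧ z s⁻¹ = u s / s ∧ w s⁻¹ = W s) ∧
      (-(s * deriv X s) * s^2 = (2 * X s ^ 2 * Y s - X s ^ 2 + c * X s) * s^2
        + 2 * a3 * u s * s + 2 * u s ^ 2 * W s + s) ∧
      (-(s * deriv Y s) = -2 * X s * Y s ^ 2 + 2 * X s * Y s - c * Y s + a1) ∧
      ((u s - s * deriv u s) * s = 2 * u s ^ 2 * W s - u s ^ 2 + (1 - 2*a4) * u s * s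
        + 2 * Y s * u s ^ 2 + s) ∧
      (-(s * deriv W s) * s = -2 * u s * W s ^ 2 + 2 * u s * W s - (1 - 2*a4) * W s * s
        - 2 * a3 * Y s * s - 4 * Y s * u s * W s + a3 * s) := by
    filter_upwards [hX, hY, hW, hu, hR, self_mem_nhdsWithin] with s hX hY hW hu hR h0
    have h0 : s ≠ 0 := h0
    obtain ⟨-, -, dz, -, e1, e2, e3, e4⟩ := hsol _ hR
    have hzs : z s⁻¹ = u s / s := by
      rw [hu.1]; simp [h0]
    have hdz : deriv (fun t => z t / t ^ 1) s⁻¹ = (deriv z s⁻¹ * s⁻¹ - z s⁻¹) / s⁻¹ ^ 2 := by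
      have := (dz.hasDerivAt.div (hasDerivAt_id (s⁻¹)) (inv_ne_zero h0)).deriv
      simpa [Pi.div_def] using this
    have hzd : s⁻¹ * deriv z s⁻¹ = (u s - s * deriv u s) / s := by
      have h2 := hu.2
      rw [hdz, hzs] at h2
      field_simp at h2 ⊢
      linear_combination h2
    rw [hX.2, ← hX.1, ← hY.1, hzs, ← hW.1] at e1
    rw [hY.2, ← hX.1, ← hY.1] at e2
    rw [hzd, ← hY.1, hzs, ← hW.1] at e3
    rw [hW.2, ← hY.1, hzs, ← hW.1] at e4
    refine ⟨h0, ⟨hX.1.symm, hY.1.symm, hzs, hW.1.symm⟩, ?_, ?_, ?_, ?_⟩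
    · rw [e1]; field_simp; simp only [hc]; ring
    · rw [e2]
    · field_simp at e3; linear_combination e3
    · rw [e4]; field_simp
  have hW00 : W 0 = 0 := by
    have := lim_aux (fun s => (2 * X s ^ 2 * Y s - X s ^ 2 + c * X s) * s^2
        + 2 * a3 * u s * s + 2 * u s ^ 2 * W s + s + (s * deriv X s) * s^2) (by fun_prop)
        (by filter_upwards [E] with s hs; linear_combination -hs.2.2.1)
    simpa [hu0, hLz] using this
  have hY00 : Y 0 = 1/2 := by
    have := lim_aux (fun s => 2 * u s ^ 2 * W s - u s ^ 2 + (1 - 2*a4) * u s * s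
        + 2 * Y s * u s ^ 2 + s - (u s - s * deriv u s) * s) (by fun_prop)
        (by filter_upwards [E] with s hs; linear_combination -hs.2.2.2.2.1)
    simp only [hW00, hu0] at this
    have h2 : Lz ^ 2 * (2 * Y 0 - 1) = 0 := by linear_combination this
    have h3 := (mul_eq_zero.1 h2).resolve_left (pow_ne_zero _ hLz)
    linear_combination h3 / 2
  obtain ⟨q, hqa, hq⟩ := div_aux Y hYa _ hY00
  obtain ⟨v, hva, hv⟩ := div_aux W hWa _ hW00
  have hqd := deriv_aux Y q hqa _ hq
  have hvd := deriv_aux W v hva _ hv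
  refine ⟨X, q, u, v, ⟨hXa, hqa, hua, hva, by rwa [hu0], ?_⟩, ?_⟩
  · filter_upwards [E, hqd, hvd] with s hs dq dv
    obtain ⟨h0, -, e1, e2, e3, e4⟩ := hs
    rw [hq, hv] at e1 e3 e4
    rw [hq] at e2
    rw [dq] at e2
    rw [dv] at e4
    refine ⟨?_, ?_, ?_, ?_⟩
    · apply mul_left_cancel₀ h0; linear_combination -e1
    · linear_combination e2
    · apply mul_left_cancel₀ h0; linear_combination e3
    · apply mul_left_cancel₀ (pow_ne_zero 2 h0); linear_combination e4
  · filter_upwards [E] with s hs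
    obtain ⟨h1, h2, h3, h4⟩ := hs.2.1
    exact ⟨h1, by rw [h2, hq], h3, by rw [h4, hv]; ring⟩

lemma red_zero {a1 a3 a4 c : ℂ} {X q u v : ℂ → ℂ} (h : Red a1 a3 a4 c X q u v) :
    2 * a4 * u 0 = 1 ∧ u 0 * v 0 = -(a3 + a4) ∧ u 0 * q 0 = a3 + a4 ∧ X 0 = c - 2 * a1 := by
  obtain ⟨hX, hq, hu, hv, u0, E⟩ := h
  have hXd := hX.deriv
  have hqd := hq.deriv
  have hud := hu.deriv
  have hvd := hv.deriv
  have e1 := lim_aux (fun s => 2 * a3 * u s + 2 * u s ^ 2 * v s + 1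
      - s * (-(s * deriv X s) - c * X s - 2 * s * X s ^ 2 * q s)) (by fun_prop)
      (by filter_upwards [E] with s hs; linear_combination hs.1)
  have e2 := lim_aux (fun s => s * (-(s * deriv q s) - q s)
      - (2 * X s * (1/4 - s^2 * q s ^ 2) - c * (1/2 + s * q s) + a1)) (by fun_prop)
      (by filter_upwards [E] with s hs; linear_combination hs.2.1)
  have e3 := lim_aux (fun s => (s * deriv u s) + (2 * u s ^ 2 * v s + 2 * u s ^ 2 * q s
      - 2 * a4 * u s + 1)) (by fun_prop)
      (by filter_upwards [E] with s hs; linear_combination -hs.2.2.1)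
  have e4 := lim_aux (fun s => (s * deriv v s) + (-2 * u s * v s ^ 2 + 2 * a4 * v s
      - 2 * a3 * q s - 4 * q s * u s * v s)) (by fun_prop)
      (by filter_upwards [E] with s hs; linear_combination -hs.2.2.2)
  simp only [zero_mul, sub_zero, zero_add] at e1 e2 e3 e4
  have hq0 : u 0 * q 0 = a3 + a4 := by
    apply mul_left_cancel₀ u0; linear_combination (e3 - e1) / 2
  have hp : (u 0 * v 0 + a3) * (u 0 * v 0 + a3 + a4) = 0 := by
    linear_combination (-u 0 / 2) * e4 - (a3 + 2 * u 0 * v 0) * hq0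
  have hne : u 0 * v 0 + a3 ≠ 0 := by
    intro h
    have : (1:ℂ) = 0 := by linear_combination e1 - 2 * u 0 * h
    exact one_ne_zero this
  have hp' := (mul_eq_zero.1 hp).resolve_left hne
  refine ⟨?_, ?_, hq0, ?_⟩
  · linear_combination -e1 + 2 * u 0 * hp'
  · linear_combination hp'
  · linear_combination (-2) * e2

lemma deriv_pow_aux (f g h : ℂ → ℂ) (hg : AnalyticAt ℂ g 0) (hh : AnalyticAt ℂ h 0) (n : ℕ)
    (H : ∀ᶠ s in 𝓝 (0:ℂ), f s = g s + s ^ n * h s) :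
    ∀ᶠ s in 𝓝[≠] (0:ℂ), f s = g s + s ^ n * h s ∧
      s * deriv f s = s * deriv g s + s ^ n * (n * h s + s * deriv h s) := by
  filter_upwards [nhdsWithin_le_nhds hg.eventually_analyticAt,
    nhdsWithin_le_nhds hh.eventually_analyticAt, nhdsWithin_le_nhds H,
    nhdsWithin_le_nhds H.eventually_nhds] with s hg hh H H'
  refine ⟨H, ?_⟩
  have e : f =ᶠ[𝓝 s] fun s => g s + s ^ n * h s := H'
  have := (hg.differentiableAt.hasDerivAt.add
    ((hasDerivAt_pow n s).mul hh.differentiableAt.hasDerivAt)).congr_of_eventuallyEq e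
  rw [this.deriv]
  rcases n with _ | n
  · simp; ring
  · simp; ring

/-- `f - g` is divisible by `s ^ n` near `0`. -/
def DivBy (f g : ℂ → ℂ) (n : ℕ) : Prop :=
  ∃ h : ℂ → ℂ, AnalyticAt ℂ h 0 ∧ ∀ᶠ s in 𝓝 (0:ℂ), f s = g s + s ^ n * h s

lemma divBy_succ {f g h : ℂ → ℂ} {n : ℕ} (hh : AnalyticAt ℂ h 0)
    (H : ∀ᶠ s in 𝓝 (0:ℂ), f s = g s + s ^ n * h s) (h0 : h 0 = 0) : DivBy f g (n+1) := by
  obtain ⟨k, hk, e⟩ := div_aux h hh 0 h0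
  refine ⟨k, hk, ?_⟩
  filter_upwards [H] with s hs
  rw [hs, e]; ring

lemma eq_of_divBy {f g : ℂ → ℂ} (hf : AnalyticAt ℂ f 0) (hg : AnalyticAt ℂ g 0)
    (H : ∀ n, DivBy f g n) : ∀ᶠ s in 𝓝 (0:ℂ), f s = g s := by
  have : analyticOrderAt (f - g) 0 = ⊤ := by
    rw [ENat.eq_top_iff_forall_ge]
    intro n
    rw [natCast_le_analyticOrderAt (hf.sub hg)]
    obtain ⟨h, hh, e⟩ := H n
    refine ⟨h, hh, ?_⟩
    filter_upwards [e] with s hs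
    simp [hs]
  rw [analyticOrderAt_eq_top] at this
  filter_upwards [this] with s hs
  exact sub_eq_zero.1 hs

lemma red_step {a1 a3 a4 c : ℂ} {X q u v X' q' u' v' : ℂ → ℂ} (h : Red a1 a3 a4 c X q u v)
    (h' : Red a1 a3 a4 c X' q' u' v') (n : ℕ)
    (ih : DivBy X X' n ∧ DivBy q q' n ∧ DivBy u u' n ∧ DivBy v v' n) :
    DivBy X X' (n+1) ∧ DivBy q q' (n+1) ∧ DivBy u u' (n+1) ∧ DivBy v v' (n+1) := by
  obtain ⟨⟨A, hA, eA⟩, ⟨Q, hQ, eQ⟩, ⟨U, hU, eU⟩, ⟨V, hV, eV⟩⟩ := ih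
  obtain ⟨z1, z2, z3, z4⟩ := red_zero h
  obtain ⟨z1', z2', z3', z4'⟩ := red_zero h'
  obtain ⟨hX, hq, hu, hv, u0, E⟩ := h
  obtain ⟨hX', hq', hu', hv', u0', E'⟩ := h'
  have dA := deriv_pow_aux X X' A hX' hA n eA
  have dQ := deriv_pow_aux q q' Q hq' hQ n eQ
  have dU := deriv_pow_aux u u' U hu' hU n eU
  have dV := deriv_pow_aux v v' V hv' hV n eV
  have hAd := hA.deriv
  have hQd := hQ.deriv
  have hUd := hU.deriv
  have hVd := hV.deriv
  have ha4 : a4 ≠ 0 := by rintro rfl; simp at z1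
  have uu : u 0 = u' 0 := by
    apply mul_left_cancel₀ ha4; linear_combination (z1 - z1') / 2
  have vv : v 0 = v' 0 := by
    apply mul_left_cancel₀ u0; rw [z2, uu, z2']
  have qq : q 0 = q' 0 := by
    apply mul_left_cancel₀ u0; rw [z3, uu, z3']
  have e1 := lim_aux (fun s => 2 * a3 * U s + 2 * ((u s + u' s) * U s * v s + u' s ^ 2 * V s)
      - s * (-(n * A s + s * deriv A s) - c * A s
        - 2 * s * ((X s + X' s) * A s * q s + X' s ^ 2 * Q s))) (by fun_prop) (by
    filter_upwards [E, E', dA, dQ, dU, dV, self_mem_nhdsWithin] with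
      s hs hs' ⟨iA, jA⟩ ⟨iQ, jQ⟩ ⟨iU, jU⟩ ⟨iV, jV⟩ h0
    apply mul_left_cancel₀ (pow_ne_zero n h0)
    have p := hs.1
    have p' := hs'.1
    rw [jA] at p
    rw [iA, iQ, iU, iV] at p ⊢
    linear_combination p - p')
  have e2 := lim_aux (fun s => s * (-(n * Q s + s * deriv Q s) - Q s)
      - (2 * A s * (1/4 - s^2 * q s ^ 2) - 2 * X' s * s^2 * (q s + q' s) * Q s
        - c * (s * Q s))) (by fun_prop) (by
    filter_upwards [E, E', dA, dQ, dU, dV, self_mem_nhdsWithin] with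
      s hs hs' ⟨iA, jA⟩ ⟨iQ, jQ⟩ ⟨iU, jU⟩ ⟨iV, jV⟩ h0
    apply mul_left_cancel₀ (pow_ne_zero n h0)
    have p := hs.2.1
    have p' := hs'.2.1
    rw [jQ] at p
    rw [iQ, iA] at p
    rw [iQ]
    linear_combination p - p')
  have e3 := lim_aux (fun s => (n * U s + s * deriv U s)
      + (2 * ((u s + u' s) * U s * (v s + q s) + u' s ^ 2 * (V s + Q s)) - 2 * a4 * U s))
      (by fun_prop) (by
    filter_upwards [E, E', dA, dQ, dU, dV, self_mem_nhdsWithin] with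
      s hs hs' ⟨iA, jA⟩ ⟨iQ, jQ⟩ ⟨iU, jU⟩ ⟨iV, jV⟩ h0
    apply mul_left_cancel₀ (pow_ne_zero n h0)
    have p := hs.2.2.1
    have p' := hs'.2.2.1
    rw [jU] at p
    rw [iQ, iU, iV] at p ⊢
    linear_combination p' - p)
  have e4 := lim_aux (fun s => (n * V s + s * deriv V s)
      + (-2 * (U s * v s ^ 2 + u' s * (v s + v' s) * V s) + 2 * a4 * V s - 2 * a3 * Q s
        - 4 * (Q s * u s * v s + q' s * U s * v s + q' s * u' s * V s)))
      (by fun_prop) (by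
    filter_upwards [E, E', dA, dQ, dU, dV, self_mem_nhdsWithin] with
      s hs hs' ⟨iA, jA⟩ ⟨iQ, jQ⟩ ⟨iU, jU⟩ ⟨iV, jV⟩ h0
    apply mul_left_cancel₀ (pow_ne_zero n h0)
    have p := hs.2.2.2
    have p' := hs'.2.2.2
    rw [jV] at p
    rw [iQ, iU, iV] at p
    rw [iU, iV]
    linear_combination p' - p)
  simp only [uu, vv, qq, zero_mul, sub_zero, add_zero] at e1 e2 e3 e4
  have hA0 : A 0 = 0 := by linear_combination (-2) * e2
  suffices hs : U 0 = 0 ∧ V 0 = 0 ∧ Q 0 = 0 from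
    ⟨divBy_succ hA eA hA0, divBy_succ hQ eQ hs.2.2, divBy_succ hU eU hs.1,
      divBy_succ hV eV hs.2.1⟩
  clear eA eQ eU eV dA dQ dU dV E E' hAd hQd hUd hVd hA hQ hU hV
  generalize u' 0 = b at *
  generalize v' 0 = d at *
  generalize q' 0 = e at *
  generalize U 0 = U₀ at *
  generalize V 0 = V₀ at *
  generalize Q 0 = Q₀ at *
  have f1 : 2 * b ^ 2 * V₀ = (2 * a3 + 4 * a4) * U₀ := by
    linear_combination e1 - 4 * U₀ * z2'
  have f3 : 2 * b ^ 2 * Q₀ = -(2 * (a3 + a4) + n) * U₀ := by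
    linear_combination e3 - f1 - 4 * U₀ * z2' - 4 * U₀ * z3'
  have f4 : 4 * a4 ^ 2 * U₀ = 0 := by
    have g : (n + 2 * a4) * (2 * b^2 * V₀) + (2 * a3 + 4 * a4) * (2 * b^2 * Q₀)
        + 4 * (a3 + a4) ^ 2 * U₀ = 0 := by
      linear_combination (2 * b^2) * e4 + (8 * b^2 * V₀ + 8 * b ^ 2 * Q₀) * z2' + (8 * b^2 * V₀) * z3' + 4 * U₀ * (b * d - (a3 + a4)) * z2' + 8 * U₀ * (b * d) * z3'
        + 8 * (a3 + a4) * U₀ * z2'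
    rw [f1, f3] at g
    linear_combination g
  have hU0 : U₀ = 0 := by
    rcases mul_eq_zero.1 f4 with h | h
    · simp [ha4] at h
    · exact h
  have hV0 : V₀ = 0 := by simpa [hU0, u0'] using f1
  have hQ0 : Q₀ = 0 := by simpa [hU0, u0'] using f3
  exact ⟨hU0, hV0, hQ0⟩

lemma red_unique {a1 a3 a4 c : ℂ} {X q u v X' q' u' v' : ℂ → ℂ} (h : Red a1 a3 a4 c X q u v)
    (h' : Red a1 a3 a4 c X' q' u' v') :
    ∀ᶠ s in 𝓝 (0:ℂ), X s = X' s ∧ q s = q' s ∧ u s = u' s ∧ v s = v' s := by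
  have key : ∀ n, DivBy X X' n ∧ DivBy q q' n ∧ DivBy u u' n ∧ DivBy v v' n := by
    intro n
    induction n with
    | zero =>
      exact ⟨⟨X - X', h.hX.sub h'.hX, by simp⟩, ⟨q - q', h.hq.sub h'.hq, by simp⟩,
        ⟨u - u', h.hu.sub h'.hu, by simp⟩, ⟨v - v', h.hv.sub h'.hv, by simp⟩⟩
    | succ n ih => exact red_step h h' n ih
  filter_upwards [eq_of_divBy h.hX h'.hX (fun n => (key n).1),
    eq_of_divBy h.hq h'.hq (fun n => (key n).2.1),
    eq_of_divBy h.hu h'.hu (fun n => (key n).2.2.1),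
    eq_of_divBy h.hv h'.hv (fun n => (key n).2.2.2)] with s h1 h2 h3 h4
  exact ⟨h1, h2, h3, h4⟩

/-- Uniqueness: two solutions of the Sasano system `B₄⁽¹⁾` near `t = ∞` for which `z` has
a pole of order exactly one at `t = ∞` and `x, y, w` are holomorphic at `t = ∞` coincide
on a neighbourhood of `t = ∞`. -/
theorem B4_pole_order_one_unique (a0 a1 a2 a3 a4 : ℂ)
    (hsum : a0 + a1 + 2*a2 + 2*a3 + 2*a4 = 1) (R1 R2 : ℝ)
    (x1 y1 z1 w1 x2 y2 z2 w2 : ℂ → ℂ)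
    (hsol1 : SolvesB4On a0 a1 a2 a3 a4 x1 y1 z1 w1 {t : ℂ | R1 < ‖t‖})
    (hsol2 : SolvesB4On a0 a1 a2 a3 a4 x2 y2 z2 w2 {t : ℂ | R2 < ‖t‖})
    (hz1 : PoleAtInftyOfOrder z1 1)
    (hx1 : HoloAtInfty x1) (hy1 : HoloAtInfty y1) (hw1 : HoloAtInfty w1)
    (hz2 : PoleAtInftyOfOrder z2 1)
    (hx2 : HoloAtInfty x2) (hy2 : HoloAtInfty y2) (hw2 : HoloAtInfty w2) :
    ∃ R' : ℝ, ∀ t : ℂ, R' < ‖t‖ →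
      x1 t = x2 t ∧ y1 t = y2 t ∧ z1 t = z2 t ∧ w1 t = w2 t := by
  obtain ⟨X, q, u, v, hr, he⟩ := red_exists a0 a1 a2 a3 a4 R1 x1 y1 z1 w1 hsol1 hz1 hx1 hy1 hw1
  obtain ⟨X', q', u', v', hr', he'⟩ :=
    red_exists a0 a1 a2 a3 a4 R2 x2 y2 z2 w2 hsol2 hz2 hx2 hy2 hw2
  have key : ∀ᶠ s in 𝓝[≠] (0:ℂ), x1 s⁻¹ = x2 s⁻¹ ∧ y1 s⁻¹ = y2 s⁻¹ ∧ z1 s⁻¹ = z2 s⁻¹ ∧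
      w1 s⁻¹ = w2 s⁻¹ := by
    filter_upwards [he, he', nhdsWithin_le_nhds (red_unique hr hr')] with
      s ⟨e1, e2, e3, e4⟩ ⟨f1, f2, f3, f4⟩ ⟨g1, g2, g3, g4⟩
    rw [e1, e2, e3, e4, f1, f2, f3, f4, g1, g2, g3, g4]
    exact ⟨rfl, rfl, rfl, rfl⟩
  have key2 := (Filter.tendsto_inv₀_cobounded' (α := ℂ)).eventually key
  rw [← comap_norm_atTop, Filter.eventually_comap] at key2
  obtain ⟨R', hR'⟩ := Filter.eventually_atTop.1 key2
  refine ⟨R', fun t ht => ?_⟩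
  simpa using hR' ‖t‖ ht.le t rfl
end
end

section
/- Let α0,α1,α2,α3,α4 be complex numbers with α0+α1+2α2+2α3+2α4=1, and let (x,y,z,w) be a solution of the Sasano system B4(α0,α1,α2,α3,α4) on a punctured neighborhood of t=0 such that y and w are meromorphic at t=0 with a pole at t=0, while x and z extend holomorphically to t=0. Then α4 ≠ 0 and α3+α4 ≠ 0, the poles of y and w at t=0 are simple, and as t→0: t·y(t) → 2α4·(α3+α4), t·w(t) → −2α4·(α3+α4), x(0)=0 with x(t)/t → (α2+α3+α4)/(2α4(α3+α4)), and z(0)=0 with z(t)/t → 1/(2α4). -/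
open Filter Topology Polynomial

noncomputable section

/-- `f` is `t^k * (L + o(1))` near the puncture `0`. -/
def HO (f : ℂ → ℂ) (k : ℤ) (L : ℂ) : Prop :=
  Tendsto (fun t => t ^ (-k) * f t) (𝓝[≠] 0) (𝓝 L)

lemma ev_ne : ∀ᶠ t : ℂ in 𝓝[≠] 0, t ≠ 0 := eventually_mem_nhdsWithin

lemma HO.congr {f g : ℂ → ℂ} {k : ℤ} {L : ℂ} (h : HO f k L) (e : ∀ᶠ t in 𝓝[≠] 0, f t = g t) :
    HO g k L := by
  refine Tendsto.congr' ?_ h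
  filter_upwards [e] with t ht
  rw [ht]

lemma HO.tendsto {f : ℂ → ℂ} {L : ℂ} (h : HO f 0 L) : Tendsto f (𝓝[≠] 0) (𝓝 L) := by
  simpa [HO] using h

lemma HO.of {f : ℂ → ℂ} {L : ℂ} (h : Tendsto f (𝓝[≠] 0) (𝓝 L)) : HO f 0 L := by
  simpa [HO] using h

lemma HO.const (c : ℂ) : HO (fun _ => c) 0 c := HO.of tendsto_const_nhds

lemma HO.mul {f g : ℂ → ℂ} {i j : ℤ} {L M : ℂ} (h : HO f i L) (h' : HO g j M) :
    HO (fun t => f t * g t) (i + j) (L * M) := by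
  refine Tendsto.congr' ?_ (Tendsto.mul h h')
  filter_upwards [ev_ne] with t ht
  rw [neg_add, zpow_add₀ ht]; ring

lemma HO.cmul {f : ℂ → ℂ} {i : ℤ} {L : ℂ} (c : ℂ) (h : HO f i L) :
    HO (fun t => c * f t) i (c * L) := by
  simpa using (HO.const c).mul h

lemma HO.add {f g : ℂ → ℂ} {i : ℤ} {L M : ℂ} (h : HO f i L) (h' : HO g i M) :
    HO (fun t => f t + g t) i (L + M) := by
  refine Tendsto.congr ?_ (Tendsto.add h h')
  intro t; ring

lemma HO.sub {f g : ℂ → ℂ} {i : ℤ} {L M : ℂ} (h : HO f i L) (h' : HO g i M) :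
    HO (fun t => f t - g t) i (L - M) := by
  refine Tendsto.congr ?_ (Tendsto.sub h h')
  intro t; ring

lemma HO.inv {f : ℂ → ℂ} {i : ℤ} {L : ℂ} (h : HO f i L) (hL : L ≠ 0) :
    HO (fun t => (f t)⁻¹) (-i) L⁻¹ := by
  refine Tendsto.congr ?_ (Tendsto.inv₀ h hL)
  intro t
  rw [mul_inv, zpow_neg t i, inv_inv, neg_neg]

lemma HO.id : HO (fun t => t) 1 1 := by
  refine Tendsto.congr' ?_ (tendsto_const_nhds (x := (1:ℂ)))
  filter_upwards [ev_ne] with t ht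
  simp [ht]

lemma HO.weaken {f : ℂ → ℂ} {i j : ℤ} {L : ℂ} (h : HO f i L) (hj : j < i) : HO f j 0 := by
  have h1 : Tendsto (fun t : ℂ => t ^ (i - j)) (𝓝[≠] 0) (𝓝 0) := by
    obtain ⟨d, hd⟩ := Int.eq_ofNat_of_zero_le (sub_nonneg.2 hj.le)
    have hd0 : d ≠ 0 := by omega
    rw [hd]
    have : Tendsto (fun t : ℂ => t ^ d) (𝓝 0) (𝓝 (0 ^ d)) := (continuous_pow d).tendsto 0
    rw [zero_pow hd0] at this
    simpa using this.mono_left nhdsWithin_le_nhds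
  have h2 := h1.mul h
  rw [zero_mul] at h2
  refine h2.congr' ?_
  filter_upwards [ev_ne] with t ht
  rw [← mul_assoc, ← zpow_add₀ ht]
  congr 2; ring

lemma HO.eq {f : ℂ → ℂ} {i : ℤ} {L M : ℂ} (h : HO f i L) (h' : HO f i M) : L = M :=
  tendsto_nhds_unique h h'

/-- nonzero leading term means the order is maximal -/
lemma HO.le {f : ℂ → ℂ} {i j : ℤ} {L M : ℂ} (h : HO f i L) (hL : L ≠ 0) (h' : HO f j M) :
    j ≤ i := by
  by_contra hlt
  exact hL (h.eq (h'.weaken (not_le.1 hlt)))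

lemma HO.ne {f : ℂ → ℂ} {i : ℤ} {L : ℂ} (h : HO f i L) (hL : L ≠ 0) :
    ∀ᶠ t in 𝓝[≠] 0, f t ≠ 0 := by
  filter_upwards [Tendsto.eventually_ne h hL] with t ht h0
  simp [h0] at ht

/-- removable singularity -/
lemma removable {f : ℂ → ℂ} {L : ℂ} (hd : ∀ᶠ t in 𝓝[≠] 0, DifferentiableAt ℂ f t)
    (h : Tendsto f (𝓝[≠] 0) (𝓝 L)) :
    ∃ F : ℂ → ℂ, AnalyticAt ℂ F 0 ∧ F 0 = L ∧ ∀ t, t ≠ 0 → f t = F t := by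
  refine ⟨Function.update f 0 L, ?_, by simp, fun t ht => by simp [ht]⟩
  apply Complex.analyticAt_of_differentiable_on_punctured_nhds_of_continuousAt
  · filter_upwards [hd, ev_ne] with t ht h0
    refine ht.congr_of_eventuallyEq ?_
    filter_upwards [isOpen_ne.mem_nhds h0] with s hs
    simp [hs]
  · exact continuousAt_update_same.2 h

lemma HO.deriv {f : ℂ → ℂ} {k : ℤ} {L : ℂ} (hd : ∀ᶠ t in 𝓝[≠] 0, DifferentiableAt ℂ f t)
    (h : HO f k L) : HO (fun t => t * deriv f t) k (k * L) := by
  obtain ⟨F, hF, hF0, hFf⟩ := removable (f := fun t => t ^ (-k) * f t) (by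
    filter_upwards [hd, ev_ne] with t ht h0
    exact (differentiableAt_zpow.2 (Or.inl h0)).mul ht) h
  have hF' : ContinuousAt (fun t => (k:ℂ) * F t + t * _root_.deriv F t) 0 :=
    (continuousAt_const.mul hF.continuousAt).add (continuousAt_id.mul hF.deriv.continuousAt)
  have h1 := hF'.tendsto.mono_left (nhdsWithin_le_nhds (s := ({0}ᶜ : Set ℂ)))
  simp only [hF0, zero_mul, add_zero] at h1
  refine h1.congr' ?_
  have hFd : ∀ᶠ t in 𝓝[≠] 0, AnalyticAt ℂ F t :=
    hF.eventually_analyticAt.filter_mono nhdsWithin_le_nhds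
  filter_upwards [ev_ne, hFd] with t ht hFt
  have e : f =ᶠ[𝓝 t] fun s => s ^ k * F s := by
    filter_upwards [isOpen_ne.mem_nhds ht] with s hs
    rw [← hFf s hs, ← mul_assoc, ← zpow_add₀ hs]; simp
  have e2 : _root_.deriv (fun s => s ^ k * F s) t = _ :=
    ((hasDerivAt_zpow k t (Or.inl ht)).mul hFt.differentiableAt.hasDerivAt).deriv
  rw [e.deriv_eq, e2, zpow_sub_one₀ ht, zpow_neg]
  have := zpow_ne_zero k ht
  field_simp

/-- existence of the order -/
lemma exists_order {f : ℂ → ℂ} {L : ℂ} (hd : ∀ᶠ t in 𝓝[≠] 0, DifferentiableAt ℂ f t)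
    (h : Tendsto f (𝓝[≠] 0) (𝓝 L)) :
    (∀ᶠ t in 𝓝[≠] 0, f t = 0) ∨ ∃ k : ℕ, ∃ M : ℂ, M ≠ 0 ∧ HO f k M := by
  obtain ⟨F, hF, hF0, hFf⟩ := removable hd h
  by_cases h0 : ∀ᶠ t in 𝓝 0, F t = 0
  · left
    filter_upwards [h0.filter_mono nhdsWithin_le_nhds, ev_ne] with t ht hne
    rw [hFf t hne, ht]
  · right
    obtain ⟨k, G, hG, hG0, hFG⟩ := hF.exists_eventuallyEq_pow_smul_nonzero_iff.2 h0
    refine ⟨k, G 0, hG0, ?_⟩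
    refine Tendsto.congr' ?_ (hG.continuousAt.tendsto.mono_left nhdsWithin_le_nhds)
    filter_upwards [hFG.filter_mono nhdsWithin_le_nhds, ev_ne] with t ht hne
    rw [hFf t hne, ht]
    simp [hne]

lemma HO.cast {f : ℂ → ℂ} {i j : ℤ} {L M : ℂ} (h : HO f i L) (hi : i = j) (hL : L = M) :
    HO f j M := by subst hi hL; exact h

/-- all relative orders being one -/
lemma final_algebra {a3 a4 Y W Z : ℂ} (hY : Y ≠ 0) (hW : W ≠ 0) (hZ : Z ≠ 0)
    (hS : 2 * (Z * W) + 2 * (Z * Y) + Z⁻¹ = 2 * a4)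
    (hR : 2 * (Z * W) + 2 * a3 * (Y * W⁻¹) + 4 * (Z * Y) = 2 * a4)
    (hT : 2 * a3 * Z + 2 * (Z * (Z * W)) + 1 = 0) :
    a4 ≠ 0 ∧ a3 + a4 ≠ 0 ∧ Y = 2*a4*(a3+a4) ∧ W = -(2*a4*(a3+a4)) ∧ Z = 1/(2*a4) := by
  obtain ⟨u, hu⟩ : ∃ u, u = Z⁻¹ := ⟨_, rfl⟩
  have hu0 : u ≠ 0 := by rw [hu]; exact inv_ne_zero hZ
  have hZu : Z = u⁻¹ := by rw [hu, inv_inv]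
  subst hZu
  field_simp at hS hR hT
  have hW' : W = -(u^2 + 2*a3*u)/2 := by
    linear_combination (1/2) * hT
  have hY' : Y = (a3+a4)*u := by
    linear_combination (1/2) * hS - hW'
  have hu4 : u = 2*a4 := by
    have h2 : u^3 * (u - 2*a4) = 0 := by
      rw [hW', hY'] at hR
      ring_nf at hR ⊢
      linear_combination (2:ℂ) * hR
    rcases mul_eq_zero.1 h2 with h | h
    · exact absurd h (pow_ne_zero 3 hu0)
    · exact sub_eq_zero.1 h
  subst hu4
  have h4 : a4 ≠ 0 := by rintro rfl; simp at hu0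
  refine ⟨h4, ?_, by rw [hY']; ring, by rw [hW']; ring, by simp⟩
  intro h; rw [h] at hY'; simp at hY'; exact hY hY'

/-- Asymptotics at `t = 0` of a solution of the Sasano system `B₄⁽¹⁾` for which `y` and
`w` have poles at `t = 0` while `x` and `z` extend holomorphically to `t = 0`. -/
theorem B4_y_w_pole_at_zero_asymptotics (a0 a1 a2 a3 a4 : ℂ)
    (hsum : a0 + a1 + 2*a2 + 2*a3 + 2*a4 = 1) (ε : ℝ) (hε : 0 < ε)
    (x y z w : ℂ → ℂ)
    (hsol : SolvesB4On a0 a1 a2 a3 a4 x y z w {t : ℂ | t ≠ 0 ∧ ‖t‖ < ε})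
    (hy : ∃ n : ℕ, 1 ≤ n ∧ ∃ L : ℂ, L ≠ 0 ∧
      Tendsto (fun t => t ^ n * y t) (𝓝[≠] 0) (𝓝 L))
    (hw : ∃ n : ℕ, 1 ≤ n ∧ ∃ L : ℂ, L ≠ 0 ∧
      Tendsto (fun t => t ^ n * w t) (𝓝[≠] 0) (𝓝 L))
    (hx : ∃ x0 : ℂ, Tendsto x (𝓝[≠] 0) (𝓝 x0))
    (hz : ∃ z0 : ℂ, Tendsto z (𝓝[≠] 0) (𝓝 z0)) :
    a4 ≠ 0 ∧ a3 + a4 ≠ 0 ∧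
    Tendsto (fun t => t * y t) (𝓝[≠] 0) (𝓝 (2*a4*(a3 + a4))) ∧
    Tendsto (fun t => t * w t) (𝓝[≠] 0) (𝓝 (-(2*a4*(a3 + a4)))) ∧
    Tendsto x (𝓝[≠] 0) (𝓝 0) ∧
    Tendsto (fun t => x t / t) (𝓝[≠] 0) (𝓝 ((a2 + a3 + a4)/(2*a4*(a3 + a4)))) ∧
    Tendsto z (𝓝[≠] 0) (𝓝 0) ∧
    Tendsto (fun t => z t / t) (𝓝[≠] 0) (𝓝 (1/(2*a4))) := by
  set c : ℂ := 1 - 2*a2 - 2*a3 - 2*a4 with hc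
  obtain ⟨n, hn, Ly, hLy, hy⟩ := hy
  obtain ⟨m, hm, Lw, hLw, hw⟩ := hw
  obtain ⟨x0, hx⟩ := hx
  obtain ⟨z0, hz⟩ := hz
  have hev : ∀ᶠ t : ℂ in 𝓝[≠] 0, t ∈ {t : ℂ | t ≠ 0 ∧ ‖t‖ < ε} := by
    have : ∀ᶠ t : ℂ in 𝓝 0, ‖t‖ < ε := by
      have := Metric.ball_mem_nhds (0:ℂ) hε
      filter_upwards [this] with t ht
      simpa using ht
    filter_upwards [ev_ne, this.filter_mono nhdsWithin_le_nhds] with t h1 h2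
    exact ⟨h1, h2⟩
  have hdx : ∀ᶠ t in 𝓝[≠] 0, DifferentiableAt ℂ x t := hev.mono fun t ht => (hsol t ht).1
  have hdy : ∀ᶠ t in 𝓝[≠] 0, DifferentiableAt ℂ y t := hev.mono fun t ht => (hsol t ht).2.1
  have hdz : ∀ᶠ t in 𝓝[≠] 0, DifferentiableAt ℂ z t := hev.mono fun t ht => (hsol t ht).2.2.1
  have hdw : ∀ᶠ t in 𝓝[≠] 0, DifferentiableAt ℂ w t := hev.mono fun t ht => (hsol t ht).2.2.2.1
  have heq : ∀ᶠ t in 𝓝[≠] 0, B4Eqs a0 a1 a2 a3 a4 x y z w t :=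
    hev.mono fun t ht => (hsol t ht).2.2.2.2
  have ex := heq.mono fun t ht => ht.1
  have ey := heq.mono fun t ht => ht.2.1
  have ez := heq.mono fun t ht => ht.2.2.1
  have ew := heq.mono fun t ht => ht.2.2.2
  have Hy : HO y (-n) Ly := by simpa [HO] using hy
  have Hw : HO w (-m) Lw := by simpa [HO] using hw
  have Hz0 : HO z 0 z0 := HO.of hz
  -- the order of `z`
  obtain ⟨k, Lz, hLz, Hz⟩ : ∃ k : ℕ, ∃ M : ℂ, M ≠ 0 ∧ HO z k M := by
    rcases exists_order hdz hz with h | h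
    · exfalso
      have hd := h
      rw [eventually_nhdsWithin_iff] at hd
      have hd := hd.eventually_nhds
      have hd := hd.filter_mono (nhdsWithin_le_nhds (s := ({0}ᶜ : Set ℂ)))
      have : ∀ᶠ t : ℂ in 𝓝[≠] 0, False := by
        filter_upwards [h, hd, ez, ev_ne] with t h1 h2 h3 h4
        have : z =ᶠ[𝓝 t] fun _ => 0 := by
          filter_upwards [h2, isOpen_ne.mem_nhds h4] with s hs hs0
          exact hs hs0
        rw [this.deriv_eq, h1] at h3
        simp at h3
        exact h4 h3.symm
      exact this.exists.elim fun _ h => h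
    · exact h
  have yne := Hy.ne hLy
  have wne := Hw.ne hLw
  have zne := Hz.ne hLz
  have Iy := (Hy.inv hLy).cast (neg_neg _) rfl
  have Iw := (Hw.inv hLw).cast (neg_neg _) rfl
  have Iz := Hz.inv hLz
  have Iy0 : HO (fun t => (y t)⁻¹) 0 0 := Iy.weaken (by omega)
  have Iw0 : HO (fun t => (w t)⁻¹) 0 0 := Iw.weaken (by omega)
  have Dy : HO (fun t => t * deriv y t * (y t)⁻¹) 0 (-n) :=
    ((Hy.deriv hdy).mul Iy).cast (by ring) (by push_cast; field_simp)
  have Dw : HO (fun t => t * deriv w t * (w t)⁻¹) 0 (-m) :=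
    ((Hw.deriv hdw).mul Iw).cast (by ring) (by push_cast; field_simp)
  have Dz : HO (fun t => t * deriv z t * (z t)⁻¹) 0 k :=
    ((Hz.deriv hdz).mul Iz).cast (by ring) (by push_cast; field_simp)
  -- the product `x y`
  have Hxy : HO (fun t => x t * y t) 0 ((1/2) * (2 * x0 - (-n) - c + a1 * 0)) := by
    refine HO.congr ((((((HO.of hx).cmul 2).sub Dy).sub (HO.const c)).add
      (Iy0.cmul a1)).cmul (1/2)) ?_
    filter_upwards [yne, ey] with t h1 h2
    rw [h2]
    field_simp
    ring
  have Hx := (Hxy.mul Iy).cast (zero_add _) rfl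
  have Hx : HO x n _ := Hx.congr (by
    filter_upwards [yne] with t h1
    field_simp)
  have hx00 : x0 = 0 := (HO.of hx).eq (Hx.weaken (by omega))
  subst hx00
  obtain ⟨Lx, hLx⟩ : ∃ Lx, Lx = (1/2) * (2 * 0 - (-n) - c + a1 * 0) * Ly⁻¹ := ⟨_, rfl⟩
  rw [← hLx] at Hx
  have hLxy : (1/2) * (2 * 0 - (-n) - c + a1 * 0) = Lx * Ly := by rw [hLx]; field_simp
  rw [hLxy] at Hxy
  have T : HO (fun t => 2 * a3 * z t + 2 * (z t * (z t * w t)) + t) n 0 := by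
    have hxx : HO (fun t => x t * x t) n 0 := (Hx.mul Hx).weaken (by omega)
    have h1 := (((Hx.deriv hdx).sub (((Hx.mul Hxy).cast (add_zero _) rfl).cmul 2)).add hxx).sub
      (Hx.cmul c)
    refine HO.congr (h1.cast rfl ?_) ?_
    · push_cast
      rw [← hLxy]; ring
    · filter_upwards [ex] with t h
      rw [h]; ring
  have S : HO (fun t => 2 * (z t * w t) + 2 * (z t * y t) + t * (z t)⁻¹) 0
      (k + z0 - (1 - 2*a4)) := by
    refine HO.congr ((Dz.add Hz0).sub (HO.const _)) ?_
    filter_upwards [ez, zne] with t h h1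
    rw [h]; field_simp; ring
  have R : HO (fun t => 2 * (z t * w t) + 2 * a3 * (y t * (w t)⁻¹) + 4 * (z t * y t)) 0
      (2 * z0 - (-m) - (1 - 2*a4)) := by
    refine HO.congr ((((Hz0.cmul 2).sub Dw).sub (HO.const (1 - 2*a4))).add (Iw0.cmul a3)
      |>.cast rfl (by ring)) ?_
    filter_upwards [ew, wne] with t h h1
    rw [h]; field_simp; ring
  have zw := Hz.mul Hw
  have zy := Hz.mul Hy
  have yw := Hy.mul Iw
  have tz := HO.id.mul Iz
  have ZW0 : Lz * Lw ≠ 0 := mul_ne_zero hLz hLw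
  have ZY0 : Lz * Ly ≠ 0 := mul_ne_zero hLz hLy
  have TZ0 : 1 * Lz⁻¹ ≠ 0 := mul_ne_zero one_ne_zero (inv_ne_zero hLz)
  have main : n = 1 ∧ m = 1 ∧ k = 1 := by
    rcases lt_trichotomy n m with hnm | hnm | hnm
    · exfalso
      have yw0 : HO (fun t => y t * (w t)⁻¹) 0 0 := yw.weaken (by omega)
      have d : HO (fun t => 2 + 4 * (y t * (w t)⁻¹)) 0 2 :=
        ((HO.const 2).add (yw0.cmul 4)).cast rfl (by ring)
      have zw0 := (R.sub (yw0.cmul (2*a3))).mul (d.inv two_ne_zero)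
      have zw0 : HO (fun t => z t * w t) _ _ := zw0.congr (by
        filter_upwards [wne, d.ne two_ne_zero] with t h1 h2
        rw [mul_inv_eq_iff_eq_mul₀ h2]
        field_simp
        ring)
      have zw0 := zw0.cast (by norm_num : _ = (0:ℤ)) rfl
      have hk := zw.le ZW0 zw0
      have zy0 : HO (fun t => z t * y t) 0 0 := zy.weaken (by omega)
      have tz0 := (S.sub (zw0.cmul 2)).sub (zy0.cmul 2)
      have tz0 : HO (fun t => t * (z t)⁻¹) 0 _ := tz0.congr (by
        filter_upwards with t
        ring)
      have hk' := tz.le TZ0 tz0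
      omega
    · subst hnm
      by_cases hk : n ≤ k
      · obtain ⟨A, hA⟩ : ∃ A, HO (fun t => z t * w t) 0 A := by
          rcases hk.lt_or_eq with h | h
          · exact ⟨_, zw.weaken (by omega)⟩
          · exact ⟨_, zw.cast (by omega) rfl⟩
        obtain ⟨B, hB⟩ : ∃ B, HO (fun t => z t * y t) 0 B := by
          rcases hk.lt_or_eq with h | h
          · exact ⟨_, zy.weaken (by omega)⟩
          · exact ⟨_, zy.cast (by omega) rfl⟩
        have tz0 := (S.sub (hA.cmul 2)).sub (hB.cmul 2)
        have tz0 : HO (fun t => t * (z t)⁻¹) 0 _ := tz0.congr (by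
          filter_upwards with t
          ring)
        have hk' := tz.le TZ0 tz0
        omega
      · exfalso
        push Not at hk
        have R' : HO _ ((k:ℤ) + -n) 0 := R.weaken (by omega)
        have yw' : HO (fun t => y t * (w t)⁻¹) ((k:ℤ) + -n) 0 := yw.weaken (by omega)
        have r := R'.eq (((zw.cmul 2).add (yw'.cmul (2*a3))).add (zy.cmul 4))
        have r' : Lw = -2 * Ly := by
          have : Lz * (Lw + 2 * Ly) = 0 := by linear_combination (-1/2) * r
          rcases mul_eq_zero.1 this with h | h
          · exact absurd h hLz
          · linear_combination h
        have S' : HO _ ((k:ℤ) + -n) 0 := S.weaken (by omega)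
        have tz0 := (S'.sub (zw.cmul 2)).sub (zy.cmul 2)
        have tz0 : HO (fun t => t * (z t)⁻¹) _ (Lz * -Lw) := (tz0.congr (by
          filter_upwards with t
          ring)).cast rfl (by rw [r']; ring)
        have o1 := tz.le TZ0 tz0
        have o2 := tz0.le (mul_ne_zero hLz (neg_ne_zero.2 hLw)) tz
        have e1 := (tz.cast (by omega) rfl).eq tz0
        have T' : HO _ 1 0 := T.weaken (by omega)
        have z1 : HO z 1 0 := Hz.weaken (by omega)
        have zzw := (Hz.mul zw).cast (by omega : _ = (1:ℤ)) rfl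
        have e2 := T'.eq (((z1.cmul (2*a3)).add (zzw.cmul 2)).add HO.id)
        field_simp at e1
        have : (1:ℂ) = 0 := by linear_combination e2 + 2 * e1
        exact one_ne_zero this
    · exfalso
      have wy := Hw.mul Iy
      have wy0 : HO (fun t => w t * (y t)⁻¹) 0 0 := wy.weaken (by omega)
      have d : HO (fun t => 4 + 2 * (w t * (y t)⁻¹)) 0 4 :=
        ((HO.const 4).add (wy0.cmul 2)).cast rfl (by ring)
      have four : (4:ℂ) ≠ 0 := by norm_num
      have q := (((R.mul wy0).cast (by norm_num : _ = (0:ℤ)) rfl).sub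
        (HO.const (2*a3))).mul (d.inv four)
      have zw0 : HO (fun t => z t * w t) 0 (-a3/2) := (q.congr (by
        filter_upwards [wne, yne, d.ne four] with t h1 h2 h3
        rw [mul_inv_eq_iff_eq_mul₀ h3]
        field_simp
        ring)).cast (by norm_num) (by ring)
      have hk := zw.le ZW0 zw0
      have T' : HO _ 1 0 := T.weaken (by omega)
      have hk1 : k = 1 := by
        by_contra hk1
        have z1 : HO z 1 0 := Hz.weaken (by omega)
        have e2 := T'.eq (((z1.cmul (2*a3)).add
          (((z1.mul zw0).cast (add_zero _) rfl).cmul 2)).add HO.id)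
        simp at e2
      subst hk1
      have tz0 := tz.cast (by norm_num : _ = (0:ℤ)) rfl
      have zy0 := ((S.sub (zw0.cmul 2)).sub tz0).cmul (1/2)
      have zy0 : HO (fun t => z t * y t) 0 _ := zy0.congr (by
        filter_upwards with t
        ring)
      have := zy.le ZY0 zy0
      omega
  obtain ⟨rfl, rfl, rfl⟩ := main
  have hz00 : z0 = 0 := Hz0.eq (Hz.weaken (by norm_num))
  subst hz00
  have zw' := zw.cast (by norm_num : _ = (0:ℤ)) rfl
  have zy' := zy.cast (by norm_num : _ = (0:ℤ)) rfl
  have yw' := yw.cast (by norm_num : _ = (0:ℤ)) rfl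
  have tz' := tz.cast (by norm_num : _ = (0:ℤ)) rfl
  have hS := S.eq (((zw'.cmul 2).add (zy'.cmul 2)).add tz')
  have hR := R.eq (((zw'.cmul 2).add (yw'.cmul (2*a3))).add (zy'.cmul 4))
  have hT := T.eq (((Hz.cmul (2*a3)).add
    (((Hz.mul zw').cast (add_zero _) rfl).cmul 2)).add HO.id)
  push_cast at hS hR
  obtain ⟨h4, h34, hY, hW, hZ⟩ := final_algebra (a3 := a3) (a4 := a4) hLy hLw hLz
    (by linear_combination -hS) (by linear_combination -hR) (by linear_combination -hT)
  refine ⟨h4, h34, ?_, ?_, hx, ?_, hz, ?_⟩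
  · rw [← hY]; simpa using hy
  · rw [← hW]; simpa using hw
  · have : Lx = (a2 + a3 + a4)/(2*a4*(a3 + a4)) := by
      rw [← hY, eq_div_iff hLy, ← hLxy, hc]
      push_cast; ring
    rw [← this]
    refine Tendsto.congr (fun t => ?_) Hx
    simp [div_eq_mul_inv, mul_comm]
  · rw [← hZ]
    refine Tendsto.congr (fun t => ?_) Hz
    simp [div_eq_mul_inv, mul_comm]
end
end

section
/- Let α0,α1,α2,α3,α4 be complex numbers with α0+α1+2α2+2α3+2α4=1, let c ∈ ℂ with c ≠ 0, and let (x,y,z,w) be a solution of the Sasano system B4(α0,α1,α2,α3,α4) on a punctured neighborhood of t=c such that x, y, z, w are all meromorphic at t=c. Then: (i) x has a pole of order at most one at t=c and Res_{t=c} x = n·c for some integer n; (ii) the function y+w has a pole of order at most two at t=c and Res_{t=c}(y+w) = 0. -/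
open Filter Topology Polynomial

noncomputable section

/-- `f` is meromorphic at `c`: after multiplication by some power of `(t - c)` it has a
finite limit as `t → c`. -/
def MeroAt (f : ℂ → ℂ) (c : ℂ) : Prop :=
  ∃ (n : ℕ) (L : ℂ), Tendsto (fun t => (t - c) ^ n * f t) (𝓝[≠] c) (𝓝 L)

/-- `f` is `(t-c)^n * g` near `c` with `g` analytic, `g c = a`. -/
def LC (c : ℂ) (f : ℂ → ℂ) (n : ℤ) (a : ℂ) : Prop :=
  ∃ g : ℂ → ℂ, AnalyticAt ℂ g c ∧ g c = a ∧ ∀ᶠ t in 𝓝[≠] c, f t = (t - c) ^ n * g t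

namespace LC
variable {c : ℂ} {f f' : ℂ → ℂ} {n m : ℤ} {a b : ℂ}

theorem ne_c (c : ℂ) : ∀ᶠ t in 𝓝[≠] c, t - c ≠ 0 := by
  filter_upwards [self_mem_nhdsWithin] with t ht
  exact sub_ne_zero.2 ht

theorem cast (h : LC c f n a) (hn : n = m) (ha : a = b) : LC c f m b := by
  subst hn ha; exact h

theorem congr (h : LC c f n a) (hf : ∀ᶠ t in 𝓝[≠] c, f' t = f t) : LC c f' n a := by
  obtain ⟨g, hg, hga, hfg⟩ := h
  refine ⟨g, hg, hga, ?_⟩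
  filter_upwards [hf, hfg] with t h1 h2
  rw [h1, h2]

theorem of_analytic (h : AnalyticAt ℂ f c) : LC c f 0 (f c) :=
  ⟨f, h, rfl, by simp⟩

theorem const (c a : ℂ) : LC c (fun _ => a) 0 a := of_analytic analyticAt_const

theorem ident (c : ℂ) : LC c (fun t => t) 0 c := of_analytic analyticAt_id

theorem low (h : LC c f n a) (hm : m < n) : LC c f m 0 := by
  obtain ⟨g, hg, hga, hfg⟩ := h
  refine ⟨fun t => (t - c) ^ (n - m).toNat * g t, by fun_prop, ?_, ?_⟩
  · have : (n - m).toNat ≠ 0 := by omega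
    simp [this]
  · filter_upwards [hfg, ne_c c] with t h1 h2
    rw [h1, ← mul_assoc, ← zpow_natCast, ← zpow_add₀ h2]
    congr 2
    omega

theorem low' (h : LC c f n a) (hm : m ≤ n) : ∃ b, LC c f m b := by
  rcases hm.lt_or_eq with h1 | h1
  · exact ⟨0, h.low h1⟩
  · exact ⟨a, h.cast h1.symm rfl⟩

theorem add (h : LC c f n a) (h' : LC c f' n b) : LC c (fun t => f t + f' t) n (a + b) := by
  obtain ⟨g, hg, hga, hfg⟩ := h
  obtain ⟨g', hg', hga', hfg'⟩ := h'
  refine ⟨fun t => g t + g' t, by fun_prop, by simp [hga, hga'], ?_⟩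
  filter_upwards [hfg, hfg'] with t h1 h2
  rw [h1, h2]; ring

theorem mul (h : LC c f n a) (h' : LC c f' m b) : LC c (fun t => f t * f' t) (n + m) (a * b) := by
  obtain ⟨g, hg, hga, hfg⟩ := h
  obtain ⟨g', hg', hga', hfg'⟩ := h'
  refine ⟨fun t => g t * g' t, by fun_prop, by simp [hga, hga'], ?_⟩
  filter_upwards [hfg, hfg', ne_c c] with t h1 h2 h3
  rw [h1, h2, zpow_add₀ h3]; ring

theorem smul (k : ℂ) (h : LC c f n a) : LC c (fun t => k * f t) n (k * a) :=
  ((const c k).mul h).cast (by ring) rfl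

theorem sub (h : LC c f n a) (h' : LC c f' n b) : LC c (fun t => f t - f' t) n (a - b) :=
  ((h.add (h'.smul (-1))).cast rfl (by ring : _ = a - b)).congr (.of_forall fun t => by ring)

theorem inv (h : LC c f n a) (ha : a ≠ 0) : LC c (fun t => (f t)⁻¹) (-n) a⁻¹ := by
  obtain ⟨g, hg, hga, hfg⟩ := h
  refine ⟨fun t => (g t)⁻¹, hg.fun_inv (by rwa [hga]), by simp [hga], ?_⟩
  filter_upwards [hfg] with t h1
  rw [h1, mul_inv, zpow_neg]

theorem ne_zero (h : LC c f n a) (ha : a ≠ 0) : ∀ᶠ t in 𝓝[≠] c, f t ≠ 0 := by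
  obtain ⟨g, hg, hga, hfg⟩ := h
  have := hg.continuousAt.eventually_ne (by rwa [hga] : g c ≠ 0)
  filter_upwards [hfg, this.filter_mono nhdsWithin_le_nhds, ne_c c] with t h1 h2 h3
  rw [h1]
  exact mul_ne_zero (zpow_ne_zero _ h3) h2

theorem uniq (h : LC c f n a) (h' : LC c f n b) : a = b := by
  obtain ⟨g, hg, hga, hfg⟩ := h
  obtain ⟨g', hg', hga', hfg'⟩ := h'
  have h1 : Tendsto g (𝓝[≠] c) (𝓝 a) := hga ▸ hg.continuousAt.tendsto.mono_left nhdsWithin_le_nhds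
  have h2 : Tendsto g' (𝓝[≠] c) (𝓝 b) :=
    hga' ▸ hg'.continuousAt.tendsto.mono_left nhdsWithin_le_nhds
  refine tendsto_nhds_unique_of_eventuallyEq h1 h2 ?_
  filter_upwards [hfg, hfg', ne_c c] with t h1 h2 h3
  rw [h1] at h2
  exact mul_left_cancel₀ (zpow_ne_zero _ h3) h2

theorem tderiv (h : LC c f n a) : LC c (deriv f) (n - 1) (n * a) := by
  obtain ⟨g, hg, hga, hfg⟩ := h
  refine ⟨fun t => n * g t + (t - c) * deriv g t, ?_, by simp [hga], ?_⟩
  · have := hg.deriv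
    fun_prop
  · have h1 : ∀ᶠ t in 𝓝[≠] c, AnalyticAt ℂ g t :=
      hg.eventually_analyticAt.filter_mono nhdsWithin_le_nhds
    have h2 : ∀ᶠ t in 𝓝[≠] c, f =ᶠ[𝓝 t] fun t => (t - c) ^ n * g t := by
      have := eventually_eventually_nhdsWithin.2 hfg
      filter_upwards [this, self_mem_nhdsWithin] with t h3 h4
      exact h3.filter_mono (by rw [IsOpen.nhdsWithin_eq isOpen_compl_singleton h4])
    filter_upwards [h1, h2, ne_c c] with t h1 h2 h3
    rw [h2.deriv_eq]
    have e1 : HasDerivAt (fun t : ℂ => (t - c) ^ n) (n * (t - c) ^ (n - 1)) t := by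
      have := (hasDerivAt_zpow n (t - c) (Or.inl h3)).comp t ((hasDerivAt_id t).sub_const c)
      simpa [Function.comp_def] using this
    rw [(e1.fun_mul h1.differentiableAt.hasDerivAt).deriv]
    rw [show (t - c) ^ n = (t - c) ^ (n - 1) * (t - c) by
      rw [← zpow_add_one₀ h3]; congr 1; ring]
    ring

theorem theta (h : LC c f n a) : LC c (fun t => t * deriv f t) (n - 1) (c * (n * a)) :=
  ((ident c).mul h.tderiv).cast (by ring) rfl

/-- Splitting off the leading term. -/
theorem split (h : LC c f n a) : ∃ g : ℂ → ℂ, AnalyticAt ℂ g c ∧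
    ∀ᶠ t in 𝓝[≠] c, f t = (t - c) ^ n * a + (t - c) ^ (n + 1) * g t := by
  obtain ⟨g, hg, hga, hfg⟩ := h
  obtain ⟨p, hp⟩ := hg
  refine ⟨dslope g c, (hp.has_fpower_series_dslope_fslope).analyticAt, ?_⟩
  filter_upwards [hfg, ne_c c] with t h1 h2
  have := sub_smul_dslope g c t
  rw [zpow_add_one₀ h2, mul_assoc, ← smul_eq_mul (t - c), this, h1, hga]; ring

theorem up (h : LC c f n 0) : ∃ b, LC c f (n + 1) b := by
  obtain ⟨g, hg, h⟩ := h.split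
  exact ⟨g c, g, hg, rfl, by simpa using h⟩

theorem theta0 (h : LC c f 0 a) : ∃ b, LC c (fun t => t * deriv f t) 0 b :=
  (h.theta.cast rfl (by simp : _ = (0:ℂ))).up

theorem dich (h : LC c f n a) : ((∀ᶠ t in 𝓝[≠] c, f t = 0) ∧ ∀ m, LC c f m 0) ∨
    ∃ m b, b ≠ 0 ∧ LC c f m b := by
  obtain ⟨g, hg, hga, hfg⟩ := h
  by_cases h0 : ∀ᶠ t in 𝓝 c, g t = 0
  · left
    have : ∀ᶠ t in 𝓝[≠] c, f t = 0 := by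
      filter_upwards [hfg, h0.filter_mono nhdsWithin_le_nhds] with t h1 h2
      rw [h1, h2, mul_zero]
    refine ⟨this, fun m => ⟨fun _ => 0, analyticAt_const, rfl, by simpa using this⟩⟩
  · right
    obtain ⟨k, q, hq, hq0, hk⟩ := hg.exists_eventuallyEq_pow_smul_nonzero_iff.2 h0
    refine ⟨n + k, q c, hq0, q, hq, rfl, ?_⟩
    filter_upwards [hfg, hk.filter_mono nhdsWithin_le_nhds, ne_c c] with t h1 h2 h3
    rw [h1, h2, zpow_add₀ h3, smul_eq_mul, zpow_natCast]; ring

theorem of_mero (hm : MeroAt f c) (hd : ∀ᶠ t in 𝓝[≠] c, DifferentiableAt ℂ f t) :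
    ∃ n a, LC c f n a := by
  obtain ⟨n, L, hL⟩ := hm
  refine ⟨-n, L, Function.update (fun t => (t - c) ^ n * f t) c L, ?_, by simp, ?_⟩
  · apply Complex.analyticAt_of_differentiable_on_punctured_nhds_of_continuousAt
    · filter_upwards [hd, self_mem_nhdsWithin] with t h1 h2
      have : DifferentiableAt ℂ (fun t => (t - c) ^ n * f t) t := by fun_prop
      refine this.congr_of_eventuallyEq ?_
      filter_upwards [isOpen_compl_singleton.mem_nhds h2] with u hu
      rw [Function.update_of_ne hu]
    · exact continuousAt_update_same.2 hL
  · filter_upwards [ne_c c] with t h1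
    rw [Function.update_of_ne (sub_ne_zero.1 h1), zpow_neg, zpow_natCast]
    field_simp

end LC

/-- The system in the canonical coordinates `(x - z, y, z, v = y + w)`. -/
structure Sys (c A B a1 a2 a3 : ℂ) (x y z v : ℂ → ℂ) : Prop where
  hc : c ≠ 0
  mx : ∃ n a, LC c x n a
  my : ∃ n a, LC c y n a
  mz : ∃ n a, LC c z n a
  E1 : ∀ᶠ t in 𝓝[≠] c, t * deriv (fun t => x t - z t) t =
    (x t - z t) * ((2 * y t - 1) * (x t + z t) + A) - 2 * a2 * z t
  E2 : ∀ᶠ t in 𝓝[≠] c, t * deriv y t = -2 * x t * (y t * (y t - 1)) - A * y t + a1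
  E3 : ∀ᶠ t in 𝓝[≠] c, t * deriv z t = z t * z t * (2 * v t - 1) + B * z t + t
  E4 : ∀ᶠ t in 𝓝[≠] c, t * deriv v t = -2 * ((x t - z t) * (y t * (y t - 1)))
    - 2 * (z t * (v t * (v t - 1))) + 2 * a2 * y t - B * v t + (a1 + a3)

namespace Sys
variable {c A B a1 a2 a3 : ℂ} {x y z v : ℂ → ℂ}

theorem md (S : Sys c A B a1 a2 a3 x y z v) : ∃ n a, LC c (fun t => x t - z t) n a := by
  obtain ⟨n, a, h⟩ := S.mx
  obtain ⟨m, b, h'⟩ := S.mz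
  obtain ⟨a', h1⟩ := h.low' (min_le_left n m)
  obtain ⟨b', h2⟩ := h'.low' (min_le_right n m)
  exact ⟨_, _, h1.sub h2⟩

/-- pole of `y` -/
theorem x_of_ypole (S : Sys c A B a1 a2 a3 x y z v) {q : ℤ} {η : ℂ} (hη : η ≠ 0) (hq : q < 0)
    (hy : LC c y q η) : ∃ ξ, LC c x (-q - 1) ξ := by
  have hN := (((hy.theta).add ((hy.smul A).low (by omega : q - 1 < q))).sub
    ((LC.const c a1).low (by omega : q - 1 < 0)))
  have hD := (hy.mul (hy.sub ((LC.const c 1).low hq))).smul (-2)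
  have hne : -2 * (η * (η - 0)) ≠ 0 := by simp [hη]
  refine ⟨_, ((hN.mul (hD.inv hne)).cast (by ring) rfl).congr ?_⟩
  filter_upwards [S.E2, hD.ne_zero hne] with t h1 h2
  rw [h1, eq_mul_inv_iff_mul_eq₀ h2]; ring

theorem x_of_yreg (S : Sys c A B a1 a2 a3 x y z v) {η : ℂ} (hη : η * (η - 1) ≠ 0)
    (hy : LC c y 0 η) : ∃ ξ, LC c x 0 ξ := by
  obtain ⟨b, hb⟩ := hy.theta0
  have hN := ((hb.add (hy.smul A)).sub (LC.const c a1))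
  have hD := (hy.mul (hy.sub (LC.const c 1))).smul (-2)
  have hne : -2 * (η * (η - 1)) ≠ 0 := by simpa using hη
  refine ⟨_, ((hN.mul (hD.inv hne)).cast (by ring) rfl).congr ?_⟩
  filter_upwards [S.E2, hD.ne_zero hne] with t h1 h2
  rw [h1, eq_mul_inv_iff_mul_eq₀ h2]; ring

/-- Either `x` is regular, or `y` is regular with value 0 or 1. -/
theorem x_cases (S : Sys c A B a1 a2 a3 x y z v) :
    (∃ ξ, LC c x 0 ξ) ∨ ∃ e, e * (e - 1) = 0 ∧ LC c y 0 e := by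
  obtain ⟨n, a, h⟩ := S.my
  rcases h.dich with ⟨-, h⟩ | ⟨q, η, hη, h⟩
  · exact Or.inr ⟨0, by simp, h 0⟩
  · rcases lt_or_ge q 0 with hq | hq
    · left
      obtain ⟨ξ, hξ⟩ := S.x_of_ypole hη hq h
      exact hξ.low' (by omega)
    · obtain ⟨e, he⟩ := h.low' hq
      by_cases h0 : e * (e - 1) = 0
      · exact Or.inr ⟨e, h0, he⟩
      · exact Or.inl (S.x_of_yreg h0 he)

/-- The analysis of `d = x - z` when `y` is regular with value 0 or 1, and `z` has at most
a simple pole. -/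
theorem d_cases (S : Sys c A B a1 a2 a3 x y z v) {e ζ : ℂ} (he : e * (e - 1) = 0)
    (hy : LC c y 0 e) (hz : LC c z (-1) ζ) :
    ∃ δ, LC c (fun t => x t - z t) (-1) δ ∧ (δ = 0 ∨ δ = - (c * (2 * e - 1)) - 2 * ζ) := by
  obtain ⟨n, a, h⟩ := S.md
  have he2 : (2 * e - 1) * (2 * e - 1) = 1 := by linear_combination 4 * he
  have he3 : (2 * e - 1) ≠ 0 := by
    intro h; rw [h] at he2; simp at he2
  rcases h.dich with ⟨-, h⟩ | ⟨p, δ, hδ, h⟩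
  · exact ⟨0, h _, Or.inl rfl⟩
  rcases lt_or_ge (-1) p with hp | hp
  · exact ⟨0, h.low hp, Or.inl rfl⟩
  have h2y := (hy.smul 2).sub (LC.const c 1)
  have key : ∀ ζ' τ, LC c z p ζ' → LC c (fun t => t * deriv (fun t => x t - z t) t) (2 * p) τ →
      τ = δ * ((2 * e - 1) * (δ + 2 * ζ')) := by
    intro ζ' τ hz' hτ
    have h1 := ((h.mul (((h2y.mul (h.add (hz'.smul 2))).cast (zero_add p) rfl).add
      ((LC.const c A).low (by omega : p < 0)))).cast (two_mul p).symm rfl).sub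
      ((hz'.smul (2 * a2)).low (by omega : 2 * p < p))
    have h2 := h1.congr (f' := fun t => t * deriv (fun t => x t - z t) t) (by
      filter_upwards [S.E1] with t h1
      rw [h1]; ring)
    rw [hτ.uniq h2]; ring
  rcases hp.lt_or_eq with hp | hp
  · exfalso
    have := key 0 0 (hz.low hp) (h.theta.low (by omega))
    simp [hδ, he3] at this
  · subst hp
    have h1 := key ζ _ hz (h.theta.cast (by ring) rfl)
    refine ⟨δ, h, Or.inr ?_⟩
    push_cast at h1
    have : δ * (δ + c * (2 * e - 1) + 2 * ζ) = 0 := by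
      linear_combination (-(2 * e - 1)) * h1 - δ * (δ + 2 * ζ) * he2
    rcases mul_eq_zero.1 this with h | h
    · exact absurd h hδ
    · linear_combination h

theorem z_lead (S : Sys c A B a1 a2 a3 x y z v) : ∃ k ζ, ζ ≠ 0 ∧ LC c z k ζ := by
  obtain ⟨n, a, h⟩ := S.mz
  rcases h.dich with ⟨h0, h⟩ | h
  · exfalso
    have h2 : ∀ᶠ t in 𝓝[≠] c, t = 0 := by
      have h4 : ∀ᶠ t in 𝓝[≠] c, z =ᶠ[𝓝 t] fun _ => 0 := by
        have := eventually_eventually_nhdsWithin.2 h0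
        filter_upwards [this, self_mem_nhdsWithin] with t h3 h4
        exact h3.filter_mono (by rw [IsOpen.nhdsWithin_eq isOpen_compl_singleton h4])
      filter_upwards [S.E3, h0, h4] with t h1 h2 h3
      rw [h3.deriv_eq, h2] at h1
      simpa using h1.symm
    have h5 := (LC.ident c).uniq (((LC.const c 0)).congr h2)
    exact S.hc h5
  · exact h

/-- formula for `2 v - 1` -/
theorem v_eq (S : Sys c A B a1 a2 a3 x y z v) {k m : ℤ} {ζ τ : ℂ} (hζ : ζ ≠ 0) (hz : LC c z k ζ)
    (hN : LC c (fun t => t * deriv z t - B * z t - t) m τ) :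
    LC c (fun t => 2 * v t - 1) (m - 2 * k) (τ / ζ ^ 2) := by
  have hD := hz.mul hz
  have hne := mul_ne_zero hζ hζ
  refine ((hN.mul (hD.inv hne)).cast (by ring) (by rw [div_eq_mul_inv, pow_two])).congr ?_
  filter_upwards [S.E3, hD.ne_zero hne] with t h1 h2
  rw [h1, eq_mul_inv_iff_mul_eq₀ h2]; ring

theorem v_of (S : Sys c A B a1 a2 a3 x y z v) {m : ℤ} {u : ℂ}
    (h : LC c (fun t => 2 * v t - 1) m u) (hm : m < 0) : LC c v m (u / 2) :=
  (((h.add ((LC.const c 1).low hm)).smul (1 / 2)).cast rfl (by ring)).congr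
    (.of_forall fun t => by ring)

theorem v_of0 (S : Sys c A B a1 a2 a3 x y z v) {u : ℂ}
    (h : LC c (fun t => 2 * v t - 1) 0 u) : LC c v 0 ((u + 1) / 2) :=
  (((h.add ((LC.const c 1))).smul (1 / 2)).cast rfl (by ring)).congr
    (.of_forall fun t => by ring)

theorem v_zpole (S : Sys c A B a1 a2 a3 x y z v) {k : ℤ} {ζ : ℂ} (hζ : ζ ≠ 0) (hk : k < 0)
    (hz : LC c z k ζ) : LC c (fun t => 2 * v t - 1) (-k - 1) (c * k / ζ) := by
  have := S.v_eq hζ hz ((hz.theta.sub ((hz.smul B).low (by omega))).sub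
    ((LC.ident c).low (by omega)))
  exact this.cast (by ring) (by field_simp; ring)

theorem x_zreg (S : Sys c A B a1 a2 a3 x y z v) {ζ : ℂ} (hz : LC c z 0 ζ) :
    ∃ n : ℤ, LC c x (-1) (n * c) := by
  rcases S.x_cases with ⟨ξ, h⟩ | ⟨e, he, hy⟩
  · exact ⟨0, (h.low (by omega)).cast rfl (by simp)⟩
  · have hz' := hz.low (by omega : (-1 : ℤ) < 0)
    obtain ⟨δ, hd, hδ⟩ := S.d_cases he hy hz'
    have hx := (hd.add hz').congr (f' := x) (.of_forall fun t => by ring)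
    rcases hδ with rfl | rfl
    · exact ⟨0, hx.cast rfl (by simp)⟩
    · rcases mul_eq_zero.1 he with h | h
      · exact ⟨1, hx.cast rfl (by rw [h]; push_cast; ring)⟩
      · exact ⟨-1, hx.cast rfl (by rw [sub_eq_zero.1 h]; push_cast; ring)⟩

theorem x_zpole (S : Sys c A B a1 a2 a3 x y z v) {k : ℤ} {ζ : ℂ} (hζ : ζ ≠ 0) (hk : k < 0)
    (hz : LC c z k ζ) : ∃ n : ℤ, LC c x (-1) (n * c) := by
  have hc := S.hc
  rcases S.x_cases with ⟨ξ, h⟩ | ⟨e, he, hy⟩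
  · exact ⟨0, (h.low (by omega)).cast rfl (by simp)⟩
  have hV := S.v_zpole hζ hk hz
  obtain ⟨u, hu⟩ := hV.low' (by omega : 0 ≤ -k - 1)
  have hv := S.v_of0 hu
  obtain ⟨τv, hτv⟩ := hv.theta0
  obtain ⟨τy, hτy⟩ := hy.theta0
  have h1 := ((hz.mul (((hy.mul (hy.sub (LC.const c 1))).sub
    (hv.mul (hv.sub (LC.const c 1)))))).cast (by ring : _ = k) rfl)
  have h2 := ((((((hτv.sub hτy).sub (hy.smul (A + 2 * a2))).add (hv.smul B))).sub
    (LC.const c a3)).smul (1 / 2)).low hk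
  have h3 := h1.uniq (h2.congr (by
    filter_upwards [S.E2, S.E4] with t h1 h2
    rw [h1, h2]; ring))
  have hu1 : u * u = 1 := by
    have : (u * u - 1) = 0 := by
      apply (mul_eq_zero.1 (_ : ζ * (u * u - 1) = 0)).resolve_left hζ
      linear_combination (-4) * h3 + 4 * ζ * he
    linear_combination this
  have hu0 : u ≠ 0 := by rintro rfl; simp at hu1
  have hk1 : k = -1 := by
    by_contra hne
    exact hu0 (hu.uniq (hV.low (by omega)))
  subst hk1
  have hζ' : ζ = - (c * u) := by
    have := hu.uniq hV
    push_cast at this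
    rw [eq_div_iff hζ] at this
    linear_combination u * this - ζ * hu1
  obtain ⟨δ, hd, hδ⟩ := S.d_cases he hy hz
  have hx := (hd.add hz).congr (f' := x) (.of_forall fun t => by ring)
  have hui : ∃ i : ℤ, u = i := by
    rcases mul_self_eq_one_iff.1 hu1 with h | h
    · exact ⟨1, by simp [h]⟩
    · exact ⟨-1, by simp [h]⟩
  have hei : ∃ i : ℤ, e = i := by
    rcases mul_eq_zero.1 he with h | h
    · exact ⟨0, by simp [h]⟩
    · exact ⟨1, by simp [sub_eq_zero.1 h]⟩
  obtain ⟨i, hi⟩ := hui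
  obtain ⟨j, hj⟩ := hei
  rcases hδ with hδ | hδ
  · exact ⟨-i, hx.cast rfl (by rw [hδ, hζ', hi]; push_cast; ring)⟩
  · exact ⟨-(2 * j - 1) + i, hx.cast rfl (by rw [hδ, hζ', hi, hj]; push_cast; ring)⟩

theorem x_main (S : Sys c A B a1 a2 a3 x y z v) : ∃ n : ℤ, LC c x (-1) (n * c) := by
  obtain ⟨k, ζ, hζ, hz⟩ := S.z_lead
  rcases lt_or_ge k 0 with hk | hk
  · exact S.x_zpole hζ hk hz
  · obtain ⟨ζ', hz'⟩ := hz.low' hk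
    exact S.x_zreg hz'

theorem z_simple (S : Sys c A B a1 a2 a3 x y z v) {k : ℤ} {ζ : ℂ} (hζ : ζ ≠ 0) (hk : 2 ≤ k)
    (hz : LC c z k ζ) : False := by
  have hc := S.hc
  have hV := S.v_eq hζ hz (((hz.theta.low (by omega : 0 < k - 1)).sub
    ((hz.smul B).low (by omega))).sub (LC.ident c))
  have hv := S.v_of hV (by omega)
  set u := (0 - 0 - c) / ζ ^ 2 / 2 with hu
  have hu0 : u ≠ 0 := by simp [hu, hc, hζ]
  -- the remaining terms of E4
  have hR : ∀ ρ, LC c (fun t => -2 * ((x t - z t) * (y t * (y t - 1))) + 2 * a2 * y t) (-3 * k) ρ →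
      ρ ≠ 0 := by
    intro ρ h1 h0
    have h2 := (hz.mul (hv.mul (hv.sub ((LC.const c 1).low (by omega))))).smul 2
    have h3 := ((hv.theta.low (by omega : -3 * k < _)).add
      ((hv.smul B).low (by omega : -3 * k < _))).sub ((LC.const c (a1 + a3)).low (by omega))
    have h4 := ((h1.sub (h2.cast (by ring) rfl)).uniq (h3.congr (by
      filter_upwards [S.E4] with t h1
      rw [h1]; ring)))
    rw [h0] at h4
    simp [hζ, hu0] at h4
  obtain ⟨n, xx⟩ := S.x_main
  have hd := xx.sub (hz.low (by omega))
  -- the case when `y` is regular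
  have hyreg : ∀ η, ¬ LC c y 0 η := by
    intro η hy
    have h1 := (hd.mul (hy.mul (hy.sub (LC.const c 1)))).smul (-2)
    refine hR _ ((h1.low (by omega : -3 * k < _)).add
      ((hy.smul (2 * a2)).low (by omega : -3 * k < _))) (by simp)
  obtain ⟨n, a, h⟩ := S.my
  rcases h.dich with ⟨-, h⟩ | ⟨q, η, hη, hy⟩
  · exact hyreg _ (h 0)
  have hq : q < 0 := by
    by_contra hq
    obtain ⟨b, hb⟩ := hy.low' (by omega : 0 ≤ q)
    exact hyreg _ hb
  obtain ⟨ξ, hx⟩ := S.x_of_ypole hη hq hy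
  rcases le_or_gt (-q - 1) k with hqk | hqk
  · obtain ⟨ζ', hz'⟩ := hz.low' hqk
    have h1 := ((hx.sub hz').mul (hy.mul (hy.sub ((LC.const c 1).low hq)))).smul (-2)
    refine hR _ ((h1.low (by omega : -3 * k < _)).add
      ((hy.smul (2 * a2)).low (by omega : -3 * k < _))) (by simp)
  · have hx' := hx.low hqk
    have hd' := hx'.sub hz
    have h1 := (hd'.mul ((((hy.smul 2).sub ((LC.const c 1).low hq)).mul (hx'.add hz)).add
      ((LC.const c A).low (by omega)))).sub ((hz.smul (2 * a2)).low (by omega))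
    have h2 := hd'.theta.low (by omega : k + (q + k) < _)
    have h3 := h2.uniq (h1.congr S.E1)
    simp [hη, hζ] at h3

theorem v_main (S : Sys c A B a1 a2 a3 x y z v) : ∃ a, LC c v (-2) a := by
  obtain ⟨k, ζ, hζ, hz⟩ := S.z_lead
  have hk : k < 2 := by
    by_contra hk
    exact S.z_simple hζ (by omega) hz
  rcases lt_or_ge k 0 with hk0 | hk0
  · obtain ⟨u, hu⟩ := (S.v_zpole hζ hk0 hz).low' (by omega : -2 ≤ -k - 1)
    exact ⟨_, S.v_of hu (by omega)⟩
  · obtain ⟨ζ', hz0⟩ := hz.low' hk0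
    obtain ⟨b, hb⟩ := hz0.theta0
    have h1 := S.v_eq hζ hz ((hb.sub (hz0.smul B)).sub (LC.ident c))
    obtain ⟨u, hu⟩ := h1.low' (by omega : -2 ≤ _)
    exact ⟨_, S.v_of hu (by omega)⟩

end Sys

/-- A derivative of a meromorphic function has no residue. -/
theorem no_residue {c : ℂ} {H v : ℂ → ℂ} {a : ℂ} (hH : ∃ n b, LC c H n b)
    (hd : ∀ᶠ t in 𝓝[≠] c, HasDerivAt H (v t) t) (hv : LC c v (-2) a) :
    ∃ (a : ℂ) (g : ℂ → ℂ), AnalyticAt ℂ g c ∧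
        ∀ᶠ t in 𝓝[≠] c, v t = a / (t - c) ^ 2 + g t := by
  obtain ⟨g, hg, h⟩ := hv.split
  have hg0 : LC c g 0 (g c) := LC.of_analytic hg
  have hinv : LC c (fun t => a * (t - c)⁻¹) (-1) a :=
    ⟨fun _ => a, analyticAt_const, rfl, .of_forall fun t => by rw [zpow_neg_one]; ring⟩
  have hK : ∃ n b, LC c (fun t => H t + a * (t - c)⁻¹) n b := by
    obtain ⟨n, b, hb⟩ := hH
    obtain ⟨_, h1⟩ := hb.low' (min_le_left n (-1))
    obtain ⟨_, h2⟩ := hinv.low' (min_le_right n (-1))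
    exact ⟨_, _, h1.add h2⟩
  have hK' : LC c (deriv (fun t => H t + a * (t - c)⁻¹)) (-1) (g c) := by
    refine ⟨g, hg, rfl, ?_⟩
    filter_upwards [hd, h, LC.ne_c c] with t h1 h2 h3
    have h4 : HasDerivAt (fun t : ℂ => a * (t - c)⁻¹) (a * (-1 / (t - c) ^ 2)) t :=
      (((hasDerivAt_id t).sub_const c).fun_inv h3).const_mul a
    rw [(h1.fun_add h4).deriv, h2]
    have e1 : (t - c) ^ (-2 : ℤ) = ((t - c) ^ 2)⁻¹ := by rw [zpow_neg]; norm_cast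
    rw [e1, show (-2 + 1 : ℤ) = -1 by norm_num]
    field_simp
    ring
  have hgc : g c = 0 := by
    have reg : ∀ b, LC c (fun t => H t + a * (t - c)⁻¹) 0 b → g c = 0 := by
      intro b hb
      exact hK'.uniq (hb.tderiv.cast (by norm_num) (by simp))
    obtain ⟨n, b, hb⟩ := hK
    rcases hb.dich with ⟨-, h0⟩ | ⟨m, b, hb0, hb⟩
    · exact reg _ (h0 0)
    · rcases lt_or_ge m 0 with hm | hm
      · exfalso
        have := hb.tderiv.uniq (hK'.low (by omega))
        simp [hb0] at this
        omega
      · obtain ⟨_, h1⟩ := hb.low' hm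
        exact reg _ h1
  obtain ⟨g2, hg2, h2⟩ := hg0.split
  refine ⟨a, g2, hg2, ?_⟩
  filter_upwards [h, h2, LC.ne_c c] with t h1 h2 h3
  have e1 : (t - c) ^ (-2 : ℤ) = ((t - c) ^ 2)⁻¹ := by rw [zpow_neg]; norm_cast
  rw [h1, h2, e1, hgc, show (-2 + 1 : ℤ) = -1 by norm_num]
  simp
  field_simp

theorem mf_add {c : ℂ} {f g : ℂ → ℂ} (hf : ∃ n b, LC c f n b) (hg : ∃ n b, LC c g n b) :
    ∃ n b, LC c (fun t => f t + g t) n b := by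
  obtain ⟨n, b, hb⟩ := hf
  obtain ⟨m, d, hd⟩ := hg
  obtain ⟨_, h1⟩ := hb.low' (min_le_left n m)
  obtain ⟨_, h2⟩ := hd.low' (min_le_right n m)
  exact ⟨_, _, h1.add h2⟩

theorem mf_mul {c : ℂ} {f g : ℂ → ℂ} (hf : ∃ n b, LC c f n b) (hg : ∃ n b, LC c g n b) :
    ∃ n b, LC c (fun t => f t * g t) n b := by
  obtain ⟨n, b, hb⟩ := hf
  obtain ⟨m, d, hd⟩ := hg
  exact ⟨_, _, hb.mul hd⟩

/-- For a solution of the Sasano system `B₄⁽¹⁾` meromorphic at `c ≠ 0`: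
(i) `x` has at worst a simple pole at `c` with residue `n·c` for some integer `n`;
(ii) `y + w` has at worst a double pole at `c` with vanishing residue. -/
theorem B4_residues_at_nonzero_point (a0 a1 a2 a3 a4 : ℂ)
    (hsum : a0 + a1 + 2*a2 + 2*a3 + 2*a4 = 1) (c : ℂ) (hc : c ≠ 0)
    (ε : ℝ) (hε : 0 < ε) (x y z w : ℂ → ℂ)
    (hsol : SolvesB4On a0 a1 a2 a3 a4 x y z w {t : ℂ | t ≠ c ∧ ‖t - c‖ < ε})
    (hx : MeroAt x c) (hy : MeroAt y c) (hz : MeroAt z c) (hw : MeroAt w c) :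
    (∃ (n : ℤ) (g : ℂ → ℂ), AnalyticAt ℂ g c ∧
        ∀ᶠ t in 𝓝[≠] c, x t = (n : ℂ) * c / (t - c) + g t) ∧
    (∃ (a : ℂ) (g : ℂ → ℂ), AnalyticAt ℂ g c ∧
        ∀ᶠ t in 𝓝[≠] c, y t + w t = a / (t - c) ^ 2 + g t) := by
  have hU : ∀ᶠ t in 𝓝[≠] c, t ≠ c ∧ ‖t - c‖ < ε := by
    have : ∀ᶠ t in 𝓝[≠] c, t ∈ Metric.ball c ε :=
      nhdsWithin_le_nhds (Metric.ball_mem_nhds c hε)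
    filter_upwards [this, self_mem_nhdsWithin] with t h1 h2
    exact ⟨h2, by simpa [dist_eq_norm] using h1⟩
  have hS : ∀ᶠ t in 𝓝[≠] c, DifferentiableAt ℂ x t ∧ DifferentiableAt ℂ y t ∧
    DifferentiableAt ℂ z t ∧ DifferentiableAt ℂ w t ∧ B4Eqs a0 a1 a2 a3 a4 x y z w t :=
    hU.mono fun t ht => hsol t ht
  have mx := LC.of_mero hx (hS.mono fun t h => h.1)
  have my := LC.of_mero hy (hS.mono fun t h => h.2.1)
  have mz := LC.of_mero hz (hS.mono fun t h => h.2.2.1)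
  have mw := LC.of_mero hw (hS.mono fun t h => h.2.2.2.1)
  have S : Sys c (1 - 2*a2 - 2*a3 - 2*a4) (1 - 2*a4) a1 a2 a3 x y z (fun t => y t + w t) := by
    refine ⟨hc, mx, my, mz, ?_, ?_, ?_, ?_⟩
    · filter_upwards [hS] with t ⟨dx, dy, dz, dw, e1, e2, e3, e4⟩
      rw [deriv_fun_sub dx dz]
      linear_combination e1 - e3
    · filter_upwards [hS] with t ⟨dx, dy, dz, dw, e1, e2, e3, e4⟩
      linear_combination e2
    · filter_upwards [hS] with t ⟨dx, dy, dz, dw, e1, e2, e3, e4⟩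
      linear_combination e3
    · filter_upwards [hS] with t ⟨dx, dy, dz, dw, e1, e2, e3, e4⟩
      rw [deriv_fun_add dy dw]
      linear_combination e2 + e4
  refine ⟨?_, ?_⟩
  · obtain ⟨n, hn⟩ := S.x_main
    obtain ⟨g, hg, h⟩ := hn.split
    refine ⟨n, g, hg, ?_⟩
    filter_upwards [h] with t h1
    rw [h1, zpow_neg_one, div_eq_inv_mul]
    simp
  · obtain ⟨a, ha⟩ := S.v_main
    have mt : ∃ n b, LC c (fun t => t) n b := ⟨_, _, LC.ident c⟩
    have mc : ∀ k : ℂ, ∃ n b, LC c (fun _ => k) n b := fun k => ⟨_, _, LC.const c k⟩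
    -- the Hamiltonian, grouped as a sum of products
    have mH : ∃ n b, LC c (fun t => x t * (y t * (x t * (y t + -1) + (1 - 2*a2 - 2*a3 - 2*a4)) + -a1)
        + (z t * (2 * a3 * y t + -a3 + w t * (z t * (2 * y t + w t + -1) + (1 - 2*a4)))
        + t * (y t + w t))) n b := by
      refine mf_add (mf_mul mx (mf_add (mf_mul my (mf_add (mf_mul mx (mf_add my (mc _))) (mc _)))
        (mc _))) (mf_add (mf_mul mz (mf_add (mf_add (mf_mul (mc _) my) (mc _))
        (mf_mul mw (mf_add (mf_mul mz (mf_add (mf_add (mf_mul (mc _) my) mw) (mc _))) (mc _)))))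
        (mf_mul mt (mf_add my mw)))
    refine no_residue mH ?_ ha
    have ht0 : ∀ᶠ t in 𝓝[≠] c, t ≠ 0 :=
      (continuousAt_id.eventually_ne hc).filter_mono nhdsWithin_le_nhds
    filter_upwards [hS, ht0] with t ⟨dx, dy, dz, dw, e1, e2, e3, e4⟩ ht
    have hx' := dx.hasDerivAt
    have hy' := dy.hasDerivAt
    have hz' := dz.hasDerivAt
    have hw' := dw.hasDerivAt
    have key := (hx'.fun_mul ((hy'.fun_mul ((hx'.fun_mul (hy'.add_const (-1))).add_const
        (1 - 2*a2 - 2*a3 - 2*a4))).add_const (-a1))).fun_add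
      ((hz'.fun_mul (((hy'.const_mul (2 * a3)).add_const (-a3)).fun_add (hw'.fun_mul
        ((hz'.fun_mul (((hy'.const_mul 2).fun_add hw').add_const (-1))).add_const (1 - 2*a4))))).fun_add
        ((hasDerivAt_id t).fun_mul (hy'.fun_add hw')))
    refine key.congr_deriv ?_
    simp only [id]
    apply mul_left_cancel₀ ht
    linear_combination (-(t * deriv y t)) * e1 + (t * deriv x t) * e2
      + (-(t * deriv w t)) * e3 + (t * deriv z t) * e4
end
end

section
/- Let α0,α1,α2,α3,α4 be complex numbers with α0+α1+2α2+2α3+2α4=1, and let (x,y,z,w) be a solution of the Sasano system B4(α0,α1,α2,α3,α4) on an annulus {|t|>R} such that z has a pole of order n ≥ 1 at t=∞ and x, y, w are holomorphic at t=∞. Let H(t) denote the Hamiltonian H_{B4} evaluated along the solution. Then H is meromorphic at t=∞, and the constant term h_{∞,0} of its Laurent expansion in powers of 1/t at t=∞ equals (α0−α1)²/4 + α3(α3+2α4−1) if n ≥ 2, and equals (α0−α1)²/4 + (α3+α4)² − (α3+α4) if n = 1. -/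
open Filter Topology Polynomial

noncomputable section

/-- The Hamiltonian `H_{B₄⁽¹⁾}` evaluated along a solution `(x,y,z,w)`. -/
def HB4 (a1 a2 a3 a4 : ℂ) (x y z w : ℂ → ℂ) (t : ℂ) : ℂ :=
  x t ^ 2 * y t * (y t - 1) + x t * ((1 - 2*a2 - 2*a3 - 2*a4) * y t - a1) + t * y t
    + z t ^ 2 * w t * (w t - 1) + z t * ((1 - 2*a4) * w t - a3) + t * w t
    + 2 * y t * z t * (z t * w t + a3)
/-- `h` is the constant term of the Laurent expansion of `f` in powers of `1/t` at
`t = ∞`: after subtracting a polynomial with zero constant coefficient, `f` tends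
to `h` as `t → ∞`. -/
def HasConstTermAtInfty (f : ℂ → ℂ) (h : ℂ) : Prop :=
  ∃ p : Polynomial ℂ, p.coeff 0 = 0 ∧
    Tendsto (fun t => f t - p.eval t) atInfty (𝓝 h)

/-- A function differentiable near infinity with a finite limit has `t f'(t) → 0`. -/
lemma tendsto_mul_deriv_zero {f : ℂ → ℂ} {R : ℝ} {L : ℂ}
    (hd : ∀ t : ℂ, R < ‖t‖ → DifferentiableAt ℂ f t) (hf : Tendsto f atInfty (𝓝 L)) :
    Tendsto (fun t => t * deriv f t) atInfty (𝓝 0) := by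
  rw [Metric.tendsto_nhds] at hf ⊢
  intro ε hε
  have h := hf (ε / 4) (by positivity)
  unfold atInfty at h ⊢
  rw [Filter.eventually_comap] at h ⊢
  rw [Filter.eventually_atTop] at h
  obtain ⟨M, hM⟩ := h
  filter_upwards [Filter.eventually_gt_atTop (2 * |M| + 2 * |R| + 1)] with r hr t ht
  subst ht
  have hM0 := le_abs_self M
  have hR0 := le_abs_self R
  have hM1 := abs_nonneg M
  have hR1 := abs_nonneg R
  have htpos : 0 < ‖t‖ := by linarith
  have far : ∀ s ∈ Metric.closedBall t (‖t‖ / 2), ‖t‖ / 2 ≤ ‖s‖ := by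
    intro s hs
    rw [Metric.mem_closedBall, dist_eq_norm] at hs
    have := norm_sub_norm_le t s
    rw [norm_sub_rev] at this
    linarith
  have hdiff : DifferentiableOn ℂ (fun s => f s - L) (Metric.closedBall t (‖t‖ / 2)) := by
    intro s hs
    have := far s hs
    exact ((hd s (by linarith)).sub_const L).differentiableWithinAt
  have hcl : DiffContOnCl ℂ (fun s => f s - L) (Metric.ball t (‖t‖ / 2)) :=
    hdiff.diffContOnCl_ball subset_rfl
  have hb := Complex.norm_deriv_le_of_forall_mem_sphere_norm_le (C := ε / 4)
    (half_pos htpos) hcl (by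
      intro s hs
      have := far s (Metric.sphere_subset_closedBall hs)
      have := hM ‖s‖ (by linarith) s rfl
      rw [dist_eq_norm] at this
      exact this.le)
  rw [deriv_sub_const] at hb
  rw [dist_eq_norm, sub_zero, norm_mul]
  calc ‖t‖ * ‖deriv f t‖ ≤ ‖t‖ * (ε / 4 / (‖t‖ / 2)) := by gcongr
    _ = ε / 2 := by field_simp; norm_num
    _ < ε := by linarith

lemma atInfty_large (R : ℝ) : ∀ᶠ t in atInfty, R < ‖t‖ := by
  unfold atInfty
  exact tendsto_comap.eventually (eventually_gt_atTop R)

instance atInfty_neBot : NeBot atInfty := by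
  unfold atInfty
  rw [comap_norm_atTop]
  infer_instance

lemma tendsto_inv_atInfty : Tendsto (fun t : ℂ => t⁻¹) atInfty (𝓝 0) := by
  unfold atInfty
  rw [comap_norm_atTop]
  exact tendsto_inv₀_cobounded

/-- The common part of both cases: `m` is the limit of `t / z`. -/
lemma B4_core (a0 a1 a2 a3 a4 : ℂ)
    (hsum : a0 + a1 + 2*a2 + 2*a3 + 2*a4 = 1) (R : ℝ) (x y z w : ℂ → ℂ)
    (hsol : SolvesB4On a0 a1 a2 a3 a4 x y z w {t : ℂ | R < ‖t‖})
    (n : ℕ) (hn : 1 ≤ n) (hz : PoleAtInftyOfOrder z n)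
    (hx : HoloAtInfty x) (hy : HoloAtInfty y) (hw : HoloAtInfty w)
    (m : ℂ) (hm : Tendsto (fun t => t / z t) atInfty (𝓝 m)) :
    Tendsto (fun t => HB4 a1 a2 a3 a4 x y z w t - t / 2) atInfty
      (𝓝 ((a0 - a1)^2/4 + (a3 + m/2)^2 - (1 - 2*a4) * (a3 + m/2) - m * (a3 + m/2))) ∧
    (a3 + m/2) * n = 2 * (a3 + m/2) * (((n : ℂ) - (1 - 2*a4) - m) + (a3 + m/2))
      + (1 - 2*a4) * (a3 + m/2) - a3 * (((n : ℂ) - (1 - 2*a4) - m) + 2 * (a3 + m/2)) := by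
  obtain ⟨X0, hX⟩ := hx
  obtain ⟨Y0, hY⟩ := hy
  obtain ⟨W0, hW⟩ := hw
  obtain ⟨L, hL, hg⟩ := hz
  have hdx := tendsto_mul_deriv_zero (fun t ht => (hsol t ht).1) hX
  have hdy := tendsto_mul_deriv_zero (fun t ht => (hsol t ht).2.1) hY
  have ht0 : ∀ᶠ t in atInfty, t ≠ 0 := by
    filter_upwards [atInfty_large 0] with t ht
    exact norm_pos_iff.mp ht
  have hg0 : ∀ᶠ t in atInfty, z t / t ^ n ≠ 0 := hg.eventually_ne hL
  have hz0 : ∀ᶠ t in atInfty, z t ≠ 0 := by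
    filter_upwards [hg0] with t ht h
    simp [h] at ht
  have hS : ∀ᶠ t in atInfty, R < ‖t‖ := atInfty_large R
  -- `1 / z → 0`
  have hzi : Tendsto (fun t => (z t)⁻¹) atInfty (𝓝 0) := by
    have h := hm.mul tendsto_inv_atInfty
    rw [mul_zero] at h
    refine h.congr' ?_
    filter_upwards [ht0, hz0] with t h1 h2
    field_simp
  -- `t z' / z → n`
  have hdz : Tendsto (fun t => t * deriv z t / z t) atInfty (𝓝 n) := by
    have h := tendsto_mul_deriv_zero (f := fun t => z t / t ^ n) (R := max R 0) (by
      intro t ht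
      have h1 : R < ‖t‖ := lt_of_le_of_lt (le_max_left _ _) ht
      have h2 : t ≠ 0 := norm_pos_iff.mp (lt_of_le_of_lt (le_max_right _ _) ht)
      exact (hsol t h1).2.2.1.div (by fun_prop) (pow_ne_zero _ h2)) hg
    have h' := (h.div hg hL).add_const (n : ℂ)
    rw [zero_div, zero_add] at h'
    refine h'.congr' ?_
    filter_upwards [ht0, hz0, hS] with t h1 h2 h3
    have hd : HasDerivAt (fun t => z t / t ^ n) _ t :=
      (hsol t h3).2.2.1.hasDerivAt.div (hasDerivAt_pow n t) (pow_ne_zero n h1)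
    simp only [Pi.div_apply]
    rw [hd.deriv]
    obtain ⟨k, rfl⟩ := Nat.exists_eq_add_of_le' hn
    simp only [Nat.add_sub_cancel]
    field_simp
    ring
  -- `z u → e`
  have hu : Tendsto (fun t => z t * (2 * w t - 1 + 2 * y t)) atInfty
      (𝓝 ((n : ℂ) - (1 - 2*a4) - m)) := by
    refine ((hdz.sub_const (1 - 2*a4)).sub hm).congr' ?_
    filter_upwards [hz0, hS] with t h2 h3
    rw [(hsol t h3).2.2.2.2.2.2.1]
    field_simp
    ring
  -- `z (z w + a3) + t / 2` converges
  have hr : Tendsto (fun t => z t * (z t * w t + a3) + t / 2) atInfty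
      (𝓝 ((0 - X0 ^ 2 * (2 * Y0 - 1) - (1 - 2*a2 - 2*a3 - 2*a4) * X0) / 2)) := by
    refine (((hdx.sub ((hX.pow 2).mul ((hY.const_mul 2).sub_const 1))).sub
      (hX.const_mul (1 - 2*a2 - 2*a3 - 2*a4))).div_const 2).congr' ?_
    filter_upwards [hS] with t h3
    rw [(hsol t h3).2.2.2.2.1]
    ring
  have hc : Tendsto (fun t => z t * w t) atInfty (𝓝 (-(a3 + m / 2))) := by
    have h := ((hr.mul hzi).sub (hm.div_const 2)).sub_const a3
    have h' : ((0 - X0 ^ 2 * (2 * Y0 - 1) - (1 - 2*a2 - 2*a3 - 2*a4) * X0) / 2) * 0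
      - m / 2 - a3 = -(a3 + m / 2) := by ring
    rw [h'] at h
    refine h.congr' ?_
    filter_upwards [hz0] with t h2
    field_simp
    ring
  have hw0 : Tendsto w atInfty (𝓝 0) := by
    have h := hc.mul hzi
    rw [mul_zero] at h
    refine h.congr' ?_
    filter_upwards [hz0] with t h2
    field_simp
  have hy0 : Tendsto y atInfty (𝓝 (1 / 2)) := by
    have h := (((hu.mul hzi).sub (hw0.const_mul 2)).add_const 1).div_const 2
    simp only [mul_zero, sub_zero, zero_add] at h
    refine h.congr' ?_
    filter_upwards [hz0] with t h2
    field_simp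
    ring
  have hYe : Y0 = 1 / 2 := tendsto_nhds_unique hY hy0
  subst hYe
  have hXe : X0 = a0 - a1 := by
    have h : Tendsto (fun t => t * deriv y t) atInfty
        (𝓝 (-2 * X0 * (1/2) ^ 2 + 2 * X0 * (1/2) - (1 - 2*a2 - 2*a3 - 2*a4) * (1/2) + a1)) := by
      refine ((((hX.const_mul (-2)).mul (hY.pow 2)).add ((hX.const_mul 2).mul hY)).sub
        (hY.const_mul (1 - 2*a2 - 2*a3 - 2*a4))).add_const a1 |>.congr' ?_
      filter_upwards [hS] with t h3
      rw [(hsol t h3).2.2.2.2.2.1]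
    have h' := tendsto_nhds_unique hdy h
    linear_combination (-2) * h' - hsum
  subst hXe
  constructor
  · have h := ((((((hX.pow 2).mul hY).mul (hY.sub_const 1)).add (hX.mul
      ((hY.const_mul (1 - 2*a2 - 2*a3 - 2*a4)).sub_const a1))).add (hc.pow 2)).add
      (hc.const_mul (1 - 2*a4))).add ((((hY.const_mul 2).sub_const 1).mul hr).add (hm.mul hc))
    have e : (a0 - a1) ^ 2 * (1/2) * (1/2 - 1)
        + (a0 - a1) * ((1 - 2*a2 - 2*a3 - 2*a4) * (1/2) - a1)
        + (-(a3 + m/2)) ^ 2 + (1 - 2*a4) * (-(a3 + m/2))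
        + ((2 * (1/2) - 1) * ((0 - (a0 - a1) ^ 2 * (2 * (1/2) - 1)
          - (1 - 2*a2 - 2*a3 - 2*a4) * (a0 - a1)) / 2) + m * (-(a3 + m/2)))
        = (a0 - a1)^2/4 + (a3 + m/2)^2 - (1 - 2*a4) * (a3 + m/2) - m * (a3 + m/2) := by
      linear_combination (-(a0 - a1) / 2) * hsum
    rw [e] at h
    refine h.congr' ?_
    filter_upwards [hz0] with t h2
    have : t / z t * (z t * w t) = t * w t := by field_simp
    rw [this]
    unfold HB4
    ring
  · have hdv := tendsto_mul_deriv_zero (f := fun t => z t * w t)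
      (fun t ht => (hsol t ht).2.2.1.mul (hsol t ht).2.2.2.1) hc
    have h1 := hdv.sub (hc.mul hdz)
    have h2 := (((hc.const_mul (-2)).mul (hu.sub hc)).sub (hc.const_mul (1 - 2*a4))).sub
      ((hu.sub (hc.const_mul 2)).const_mul a3)
    have h3 := tendsto_nhds_unique (h1.congr' ?_) h2
    · linear_combination h3
    · filter_upwards [hz0, hS] with t g2 g3
      have hd : HasDerivAt (fun t => z t * w t) _ t :=
        (hsol t g3).2.2.1.hasDerivAt.mul (hsol t g3).2.2.2.1.hasDerivAt
      rw [hd.deriv]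
      have k : z t * w t * (t * deriv z t / z t) = w t * (t * deriv z t) := by field_simp
      rw [k]
      linear_combination z t * (hsol t g3).2.2.2.2.2.2.2

/-- The constant term at `t = ∞` of the Hamiltonian along a solution of the Sasano
system `B₄⁽¹⁾` whose `z` has a pole of order `n ≥ 1` at `t = ∞` while `x, y, w` are
holomorphic at `t = ∞`; in particular the Hamiltonian is meromorphic at `t = ∞`. -/
theorem B4_hamiltonian_const_term_at_infinity (a0 a1 a2 a3 a4 : ℂ)
    (hsum : a0 + a1 + 2*a2 + 2*a3 + 2*a4 = 1) (R : ℝ) (x y z w : ℂ → ℂ)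
    (hsol : SolvesB4On a0 a1 a2 a3 a4 x y z w {t : ℂ | R < ‖t‖})
    (n : ℕ) (hn : 1 ≤ n) (hz : PoleAtInftyOfOrder z n)
    (hx : HoloAtInfty x) (hy : HoloAtInfty y) (hw : HoloAtInfty w) :
    (2 ≤ n → HasConstTermAtInfty (HB4 a1 a2 a3 a4 x y z w)
        ((a0 - a1)^2/4 + a3*(a3 + 2*a4 - 1))) ∧
    (n = 1 → HasConstTermAtInfty (HB4 a1 a2 a3 a4 x y z w)
        ((a0 - a1)^2/4 + (a3 + a4)^2 - (a3 + a4))) := by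
  obtain ⟨L, hL, hg⟩ := id hz
  have ht0 : ∀ᶠ t in atInfty, t ≠ 0 := by
    filter_upwards [atInfty_large 0] with t ht
    exact norm_pos_iff.mp ht
  have hp0 : (C (1/2 : ℂ) * X).coeff 0 = 0 := by simp
  have hpe : ∀ t : ℂ, (C (1/2 : ℂ) * X).eval t = t / 2 := by
    intro t
    simp
    ring
  constructor
  · intro hn2
    have hm : Tendsto (fun t => t / z t) atInfty (𝓝 0) := by
      have h := (hg.inv₀ hL).mul (tendsto_inv_atInfty.pow (n - 1))
      rw [zero_pow (by omega), mul_zero] at h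
      refine h.congr' ?_
      filter_upwards [ht0] with t h1
      obtain ⟨k, rfl⟩ := Nat.exists_eq_add_of_le' hn
      simp only [Nat.add_sub_cancel]
      rw [inv_div, inv_pow, pow_succ]
      field_simp
    have h := (B4_core a0 a1 a2 a3 a4 hsum R x y z w hsol n hn hz hx hy hw 0 hm).1
    refine ⟨C (1/2 : ℂ) * X, hp0, ?_⟩
    simp only [hpe]
    convert h using 2
    ring
  · intro hn1
    subst hn1
    have hm : Tendsto (fun t => t / z t) atInfty (𝓝 L⁻¹) := by
      refine (hg.inv₀ hL).congr' ?_
      filter_upwards with t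
      rw [inv_div, pow_one]
    obtain ⟨h, h'⟩ := B4_core a0 a1 a2 a3 a4 hsum R x y z w hsol 1 hn hz hx hy hw L⁻¹ hm
    have hL' : L⁻¹ ≠ 0 := inv_ne_zero hL
    have hma : L⁻¹ = 2 * a4 := by
      apply mul_left_cancel₀ hL'
      push_cast at h'
      linear_combination 2 * h'
    rw [hma] at h
    refine ⟨C (1/2 : ℂ) * X, hp0, ?_⟩
    simp only [hpe]
    convert h using 2
    ring
end
end
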